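/- arXiv:1911.10703 — 5 statements merged into one kernel-verified Lean document; each statement's English description precedes it below -/
import Mathlib

section
/- Let n ≥ 2 and k ≥ 1 be integers, and let H = PS_{n+1}^{(k)}, a multigraph on vertices {0, 1, …, n+1}. Let K denote the Kostant partition function of H evaluated at the net flow vector that assigns n−1 to vertex 0, −1 to each of the vertices 1, 2, …, n−1, and 0 to vertex n. Then (kn − 1) · K = binom((k+1)n − 2, n). Equivalently, the Ehrhart-like polynomial of the Pitman–Stanley graph satisfies E_{PS_{n+1}}(k) = (1/(kn−1)) · binom((k+1)n−2, n). -/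
/-- The Kostant partition function of a directed multigraph whose edges are
indexed by `E`, with source `src` and target `tgt`, evaluated at the net flow
vector `a`: the number of nonnegative integer flows `b` on the edges such that
for every vertex `v` other than the last vertex `V`, the net outflow at `v`
equals `a v`. -/
noncomputable def kostant {E : Type} [Fintype E] (src tgt : E → ℕ) (V : ℕ) (a : ℕ → ℤ) : ℕ :=
  Nat.card { b : E → ℕ // ∀ v < V,
    ((∑ e : E, if src e = v then (b e : ℤ) else 0) -
     (∑ e : E, if tgt e = v then (b e : ℤ) else 0)) = a v }

/-- Edge index type of `PS_{n+1}^{(k)}`: path edges `(i,i+1)` for `1 ≤ i ≤ n`,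
side edges `(i,n+1)` for `1 ≤ i ≤ n-1`, and `k` parallel edges `(0,i)` for
each `1 ≤ i ≤ n+1`. -/
abbrev PSkEdge (n k : ℕ) : Type := Fin n ⊕ Fin (n - 1) ⊕ Fin k × Fin (n + 1)

def psSrc (n k : ℕ) : PSkEdge n k → ℕ :=
  Sum.elim (fun i => (i : ℕ) + 1) (Sum.elim (fun i => (i : ℕ) + 1) (fun _ => 0))

def psTgt (n k : ℕ) : PSkEdge n k → ℕ :=
  Sum.elim (fun i => (i : ℕ) + 2) (Sum.elim (fun _ => n + 1) (fun e => (e.2 : ℕ) + 1))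

/-- The net flow vector assigning `n-1` to vertex `0`, `-1` to vertices
`1,…,n-1`, and `0` to vertex `n`. -/
def psFlow (n : ℕ) : ℕ → ℤ :=
  fun v => if v = 0 then (n : ℤ) - 1 else if v ≤ n - 1 then -1 else 0

open Finset

theorem card_fun_sum_eq (α : Type) [Fintype α] [DecidableEq α] (m : ℕ) :
    Nat.card {c : α → ℕ // ∑ p, c p = m} = (Fintype.card α + m - 1).choose m := by
  rw [← Nat.card_congr (Sym.equivNatSumOfFintype α m), Nat.card_eq_fintype_card,
    Sym.card_sym_eq_choose]

/-- Cycle lemma for the partial sums of a sequence whose increments are periodic with total `-1`. -/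
theorem existsUnique_forall_le_add (n : ℕ) (hn : 0 < n) (S : ℕ → ℤ)
    (hS : ∀ j, S (j + n) = S j - 1) :
    ∃! r : Fin n, ∀ j < n, S r ≤ S (r + j) := by
  have hex : ∃ r, r < n ∧ ∀ i < n, S r ≤ S i := by
    obtain ⟨r, hr, h⟩ := exists_min_image (range n) S ⟨0, by simpa⟩
    exact ⟨r, by simpa using hr, fun i hi => h i (by simpa)⟩
  classical
  obtain ⟨hr, hmin⟩ := Nat.find_spec hex
  have hfirst : ∀ i < Nat.find hex, S (Nat.find hex) < S i := by
    intro i hi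
    by_contra! hle
    exact Nat.find_min hex hi ⟨hi.trans hr, fun l hl => hle.trans (hmin l hl)⟩
  generalize Nat.find hex = r at *
  have hrgood : ∀ j < n, S r ≤ S (r + j) := by
    intro j hj
    rcases lt_or_ge (r + j) n with h | h
    · exact hmin _ h
    · have h1 := hfirst (r + j - n) (by omega)
      have h2 := hS (r + j - n)
      rw [Nat.sub_add_cancel h] at h2
      omega
  refine ⟨⟨r, hr⟩, hrgood, ?_⟩
  · have key : ∀ a b : ℕ, a < b → b < n → (∀ j < n, S a ≤ S (a + j)) →
        (∀ j < n, S b ≤ S (b + j)) → False := by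
      intro a b hab hb ha hb'
      have h1 := ha (b - a) (by omega)
      have h2 := hb' (a + n - b) (by omega)
      have h3 := hS a
      rw [show a + (b - a) = b by omega] at h1
      rw [show b + (a + n - b) = a + n by omega] at h2
      omega
    rintro ⟨s, hs⟩ hsgood
    rcases lt_trichotomy s r with h | h | h
    · exact (key s r h hr hsgood hrgood).elim
    · exact Fin.ext h
    · exact (key r s h hs hrgood hsgood).elim

/-- The first `j` column sums of `c`, read cyclically, add up to `partialSum c j`. -/
def partialSum {n k : ℕ} [NeZero n] (c : Fin k × Fin n → ℕ) (j : ℕ) : ℕ :=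
  ∑ t ∈ range j, ∑ a, c (a, Fin.ofNat n t)

/-- The matrices with `n` columns and total `n - 1` whose partial sums dominate `0, 1, …, n - 1`. -/
def IsDominating {n k : ℕ} [NeZero n] (c : Fin k × Fin n → ℕ) : Prop :=
  ∑ p, c p = n - 1 ∧ ∀ j < n, j ≤ partialSum c j

/-- Cyclic shift of the columns. -/
def rotateColumns {n k : ℕ} [NeZero n] (r : Fin n) :
    (Fin k × Fin n → ℕ) ≃ (Fin k × Fin n → ℕ) :=
  Equiv.arrowCongr ((Equiv.refl _).prodCongr (Equiv.addRight r)).symm (Equiv.refl ℕ)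

theorem rotateColumns_apply {n k : ℕ} [NeZero n] (r : Fin n) (c : Fin k × Fin n → ℕ)
    (p : Fin k × Fin n) : rotateColumns r c p = c (p.1, p.2 + r) := rfl

theorem sum_rotateColumns {n k : ℕ} [NeZero n] (r : Fin n) (c : Fin k × Fin n → ℕ) :
    ∑ p, rotateColumns r c p = ∑ p, c p :=
  Equiv.sum_comp ((Equiv.refl _).prodCongr (Equiv.addRight r)) c

theorem partialSum_self {n k : ℕ} [NeZero n] (c : Fin k × Fin n → ℕ) :
    partialSum c n = ∑ p, c p := by
  rw [partialSum, sum_range, Fintype.sum_prod_type_right]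
  refine sum_congr rfl fun i _ => ?_
  simp [Fin.ofNat_eq_cast]

theorem partialSum_add {n k : ℕ} [NeZero n] (c : Fin k × Fin n → ℕ) (r : Fin n) (j : ℕ) :
    partialSum c (r + j) = partialSum c r + partialSum (rotateColumns r c) j := by
  rw [partialSum, sum_range_add]
  congr 1
  refine sum_congr rfl fun t _ => sum_congr rfl fun a _ => ?_
  rw [rotateColumns_apply]
  congr 2
  ext
  simp [Fin.val_add, add_comm]

theorem partialSum_add_self {n k : ℕ} [NeZero n] (c : Fin k × Fin n → ℕ) (j : ℕ) :
    partialSum c (j + n) = partialSum c j + ∑ p, c p := by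
  rw [add_comm, partialSum, sum_range_add, ← partialSum_self, add_comm, partialSum]
  congr 1
  refine sum_congr rfl fun t _ => sum_congr rfl fun a _ => ?_
  congr 2
  ext
  simp

theorem existsUnique_isDominating_rotateColumns {n k : ℕ} [NeZero n] (c : Fin k × Fin n → ℕ)
    (hc : ∑ p, c p = n - 1) : ∃! r : Fin n, IsDominating (rotateColumns r c) := by
  have hn : 0 < n := Nat.pos_of_neZero n
  have h := existsUnique_forall_le_add n hn (fun j => (partialSum c j : ℤ) - j) (by
    intro j
    simp only [partialSum_add_self, hc]
    omega)
  refine (existsUnique_congr fun r => ?_).mp h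
  rw [IsDominating, sum_rotateColumns]
  simp only [hc, true_and, partialSum_add]
  refine forall₂_congr fun j _ => ?_
  omega

theorem mul_card_isDominating (n k : ℕ) [NeZero n] :
    n * Nat.card {c : Fin k × Fin n → ℕ // IsDominating c} =
      Nat.card {c : Fin k × Fin n → ℕ // ∑ p, c p = n - 1} := by
  have e : Fin n × {c : Fin k × Fin n → ℕ // IsDominating c} ≃
      {c : Fin k × Fin n → ℕ // ∑ p, c p = n - 1} := by
    refine Equiv.ofBijective
      (fun x => ⟨(rotateColumns x.1).symm x.2.1, ?_⟩) ⟨?_, ?_⟩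
    · rw [← sum_rotateColumns x.1, Equiv.apply_symm_apply]
      exact x.2.2.1
    · rintro ⟨r, c, hc⟩ ⟨s, d, hd⟩ h
      simp only [Subtype.mk.injEq] at h
      have hsum : ∑ p, (rotateColumns r).symm c p = n - 1 := by
        rw [← sum_rotateColumns r, Equiv.apply_symm_apply]
        exact hc.1
      obtain rfl : r = s := by
        refine (existsUnique_isDominating_rotateColumns _ hsum).unique ?_ ?_
        · rwa [Equiv.apply_symm_apply]
        · rwa [h, Equiv.apply_symm_apply]
      simpa using h
    · rintro ⟨c, hc⟩
      obtain ⟨r, hr, -⟩ := existsUnique_isDominating_rotateColumns c hc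
      exact ⟨(r, ⟨_, hr⟩), by simp⟩
  rw [← Nat.card_congr e, Nat.card_prod, Nat.card_fin]

theorem sum_fin_ite_of_iff_eq {m : ℕ} (f : Fin m → ℕ) (w : ℕ) (P : Fin m → Prop)
    [DecidablePred P] (hP : ∀ i, P i ↔ (i : ℕ) = w) :
    (∑ i, if P i then (f i : ℤ) else 0) = ((if h : w < m then f ⟨w, h⟩ else 0 : ℕ) : ℤ) := by
  split_ifs with h
  · rw [sum_eq_single ⟨w, h⟩]
    · rw [if_pos ((hP _).mpr rfl)]
    · intro i _ hi
      rw [if_neg fun h' => hi (Fin.ext ((hP i).mp h'))]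
    · simp
  · refine sum_eq_zero fun i _ => if_neg ?_
    rw [hP]
    omega

/-- Flow on the path edge leaving vertex `w + 1`. -/
def pathFlow {n k : ℕ} (b : PSkEdge n k → ℕ) (w : ℕ) : ℕ :=
  if h : w < n then b (.inl ⟨w, h⟩) else 0

/-- Flow on the side edge leaving vertex `w + 1`. -/
def sideFlow {n k : ℕ} (b : PSkEdge n k → ℕ) (w : ℕ) : ℕ :=
  if h : w < n - 1 then b (.inr (.inl ⟨w, h⟩)) else 0

/-- Total flow from vertex `0` to vertex `w + 1`. -/
def rootFlow {n k : ℕ} (b : PSkEdge n k → ℕ) (w : ℕ) : ℕ :=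
  if h : w < n + 1 then ∑ a, b (.inr (.inr (a, ⟨w, h⟩))) else 0

/-- The defining condition of the flows counted by the Kostant partition function. -/
def IsPSFlow {n k : ℕ} (b : PSkEdge n k → ℕ) : Prop :=
  ∀ v < n + 1, ((∑ e, if psSrc n k e = v then (b e : ℤ) else 0) -
    (∑ e, if psTgt n k e = v then (b e : ℤ) else 0)) = psFlow n v

theorem sum_range_rootFlow {n k : ℕ} (b : PSkEdge n k → ℕ) :
    ∑ t ∈ range (n + 1), rootFlow b t = ∑ e, b (.inr (.inr e)) := by
  rw [sum_range, Fintype.sum_prod_type_right]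
  exact sum_congr rfl fun i _ => dif_pos i.2

theorem netFlow_zero {n k : ℕ} (b : PSkEdge n k → ℕ) :
    ((∑ e, if psSrc n k e = 0 then (b e : ℤ) else 0) -
      (∑ e, if psTgt n k e = 0 then (b e : ℤ) else 0)) =
      ((∑ t ∈ range (n + 1), rootFlow b t : ℕ) : ℤ) := by
  simp [sum_range_rootFlow, psSrc, psTgt, Fintype.sum_sum_type]

theorem netFlow_succ {n k : ℕ} (b : PSkEdge n k → ℕ) {w : ℕ} (hw : w < n) :
    ((∑ e, if psSrc n k e = w + 1 then (b e : ℤ) else 0) -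
      (∑ e, if psTgt n k e = w + 1 then (b e : ℤ) else 0)) =
      pathFlow b w + sideFlow b w - (if w = 0 then 0 else (pathFlow b (w - 1) : ℤ))
        - rootFlow b w := by
  have hpathSrc : (∑ i, if psSrc n k (.inl i) = w + 1 then (b (.inl i) : ℤ) else 0) =
      pathFlow b w :=
    sum_fin_ite_of_iff_eq (fun i => b (.inl i)) w _ fun i => Nat.add_right_cancel_iff
  have hsideSrc : (∑ i, if psSrc n k (.inr (.inl i)) = w + 1 then (b (.inr (.inl i)) : ℤ) else 0) =
      sideFlow b w :=
    sum_fin_ite_of_iff_eq (fun i => b (.inr (.inl i))) w _ fun i => Nat.add_right_cancel_iff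
  have hrootSrc : (∑ e, if psSrc n k (.inr (.inr e)) = w + 1 then
      (b (.inr (.inr e)) : ℤ) else 0) = 0 :=
    sum_eq_zero fun e _ => if_neg (Nat.succ_ne_zero w).symm
  have hpathTgt : (∑ i, if psTgt n k (.inl i) = w + 1 then (b (.inl i) : ℤ) else 0) =
      if w = 0 then 0 else (pathFlow b (w - 1) : ℤ) := by
    split_ifs with h
    · refine sum_eq_zero fun i _ => if_neg ?_
      simp only [psTgt, Sum.elim_inl]
      omega
    · refine sum_fin_ite_of_iff_eq (fun i => b (.inl i)) (w - 1) _ fun i => ?_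
      simp only [psTgt, Sum.elim_inl]
      omega
  have hsideTgt : (∑ i, if psTgt n k (.inr (.inl i)) = w + 1 then
      (b (.inr (.inl i)) : ℤ) else 0) = 0 := by
    refine sum_eq_zero fun i _ => if_neg ?_
    simp only [psTgt, Sum.elim_inl, Sum.elim_inr]
    omega
  have hrootTgt : (∑ e, if psTgt n k (.inr (.inr e)) = w + 1 then
      (b (.inr (.inr e)) : ℤ) else 0) = rootFlow b w := by
    rw [Fintype.sum_prod_type, rootFlow, dif_pos (by omega), Nat.cast_sum]
    refine sum_congr rfl fun a _ => ?_
    refine (sum_fin_ite_of_iff_eq (fun i => b (.inr (.inr (a, i)))) w _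
      fun i => Nat.add_right_cancel_iff).trans ?_
    rw [dif_pos]
  simp only [Fintype.sum_sum_type]
  rw [hpathSrc, hsideSrc, hrootSrc, hpathTgt, hsideTgt, hrootTgt]
  ring

theorem isPSFlow_iff_conservation {n k : ℕ} (hn : 2 ≤ n) (b : PSkEdge n k → ℕ) :
    IsPSFlow b ↔ ∑ t ∈ range (n + 1), rootFlow b t = n - 1 ∧
      ∀ w < n, (pathFlow b w + sideFlow b w - (if w = 0 then 0 else (pathFlow b (w - 1) : ℤ))
        - rootFlow b w) = if w < n - 1 then -1 else 0 := by
  rw [IsPSFlow, Nat.forall_lt_succ_left', netFlow_zero]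
  refine and_congr ?_ (forall₂_congr fun w hw => ?_)
  · simp only [psFlow, if_true]
    omega
  · rw [netFlow_succ b hw, psFlow, if_neg (Nat.succ_ne_zero w)]
    simp only [Nat.succ_le_iff]

theorem conservation_iff_partial_sums (n : ℕ) (p s x : ℕ → ℕ) :
    (∀ w < n, ((p w : ℤ) + s w - (if w = 0 then 0 else (p (w - 1) : ℤ)) - x w) =
      if w < n - 1 then -1 else 0) ↔
    ∀ j < n, p j + ∑ t ∈ range (j + 1), s t + min (j + 1) (n - 1) =
      ∑ t ∈ range (j + 1), x t := by
  constructor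
  · intro h j
    induction j with
    | zero =>
      intro hj
      have := h 0 hj
      simp only [if_true, zero_add, sum_range_one] at this ⊢
      split_ifs at this <;> omega
    | succ j ih =>
      intro hj
      have h1 := ih (by omega)
      have h2 := h (j + 1) hj
      rw [sum_range_succ s, sum_range_succ x]
      simp only [Nat.succ_ne_zero, if_false, Nat.add_sub_cancel] at h2
      split_ifs at h2 <;> omega
  · rintro h (_ | w) hw
    · have := h 0 hw
      simp only [if_true, zero_add, sum_range_one] at this ⊢
      split_ifs <;> omega
    · have h1 := h w (by omega)
      have h2 := h (w + 1) hw
      rw [sum_range_succ s, sum_range_succ x] at h2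
      simp only [Nat.succ_ne_zero, if_false, Nat.add_sub_cancel]
      split_ifs <;> omega

theorem partial_sums_iff_dominating {n : ℕ} (hn : 2 ≤ n) (p s x : ℕ → ℕ)
    (hs : ∀ t, n - 1 ≤ t → s t = 0)
    (hx : ∑ t ∈ range (n + 1), x t = n - 1) :
    (∀ j < n, p j + ∑ t ∈ range (j + 1), s t + min (j + 1) (n - 1) =
      ∑ t ∈ range (j + 1), x t) ↔
    (∀ t, s t = 0) ∧ x n = 0 ∧ (∀ j < n, j ≤ ∑ t ∈ range j, x t) ∧
      ∀ j < n, p j = ∑ t ∈ range (j + 1), x t - (j + 1) := by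
  rw [sum_range_succ] at hx
  constructor
  · intro h
    have hlast := h (n - 1) (by omega)
    rw [Nat.sub_add_cancel (by omega)] at hlast
    have hsum : ∑ t ∈ range n, s t = 0 := by omega
    have hs0 : ∀ t, s t = 0 := by
      intro t
      rcases lt_or_ge t n with ht | ht
      · exact sum_eq_zero_iff.mp hsum t (mem_range.mpr ht)
      · exact hs t (by omega)
    simp only [hs0, sum_const_zero, add_zero] at h hlast
    refine ⟨hs0, by omega, ?_, fun j hj => ?_⟩
    · rintro (_ | j) hj
      · simp
      · have := h j (by omega)
        omega
    · have := h j hj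
      rcases Nat.lt_or_ge (j + 1) n with hj' | hj'
      · omega
      · obtain rfl : j = n - 1 := by omega
        rw [Nat.sub_add_cancel (by omega)] at this ⊢
        omega
  · rintro ⟨hs0, hxn, hdom, hp⟩ j hj
    simp only [hs0, sum_const_zero, add_zero, hp j hj]
    rcases Nat.lt_or_ge (j + 1) n with hj' | hj'
    · have := hdom (j + 1) hj'
      omega
    · obtain rfl : j = n - 1 := by omega
      rw [Nat.sub_add_cancel (by omega)]
      omega

/-- The flows out of vertex `0`, without those into the last vertex. -/
def rootMatrix {n k : ℕ} (b : PSkEdge n k → ℕ) : Fin k × Fin n → ℕ :=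
  fun e => b (.inr (.inr (e.1, e.2.castSucc)))

/-- The flow with given root edges, zero on the side edges and on edges from `0` to the last
vertex. -/
def flowOfMatrix {n k : ℕ} [NeZero n] (c : Fin k × Fin n → ℕ) : PSkEdge n k → ℕ :=
  Sum.elim (fun i => partialSum c (i + 1) - (i + 1))
    (Sum.elim (fun _ => 0) fun e => if h : (e.2 : ℕ) < n then c (e.1, ⟨e.2, h⟩) else 0)

theorem rootMatrix_flowOfMatrix {n k : ℕ} [NeZero n] (c : Fin k × Fin n → ℕ) :
    rootMatrix (flowOfMatrix c) = c := by
  ext ⟨a, i⟩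
  simp [rootMatrix, flowOfMatrix]

theorem partialSum_rootMatrix {n k : ℕ} [NeZero n] (b : PSkEdge n k → ℕ) {j : ℕ} (hj : j ≤ n) :
    partialSum (rootMatrix b) j = ∑ t ∈ range j, rootFlow b t := by
  refine sum_congr rfl fun t ht => ?_
  have ht' : t < n := (mem_range.mp ht).trans_le hj
  rw [rootFlow, dif_pos (by omega)]
  refine sum_congr rfl fun a _ => ?_
  rw [rootMatrix]
  congr 4
  ext
  simp [Nat.mod_eq_of_lt ht']

theorem eq_flowOfMatrix_iff {n k : ℕ} [NeZero n] (b : PSkEdge n k → ℕ) :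
    b = flowOfMatrix (rootMatrix b) ↔
      (∀ t, sideFlow b t = 0) ∧ rootFlow b n = 0 ∧
        ∀ j < n, pathFlow b j = ∑ t ∈ range (j + 1), rootFlow b t - (j + 1) := by
  constructor
  · intro h
    refine ⟨fun t => ?_, ?_, fun j hj => ?_⟩
    · rw [h, sideFlow]
      simp [flowOfMatrix]
    · rw [h, rootFlow]
      simp [flowOfMatrix]
    · rw [← partialSum_rootMatrix b hj, pathFlow, dif_pos hj]
      conv_lhs => rw [h]
      rfl
  · rintro ⟨hs, hr, hp⟩
    ext (i | i | ⟨a, i⟩)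
    · have := hp i i.2
      rw [pathFlow, dif_pos i.2, ← partialSum_rootMatrix b i.2] at this
      exact this
    · have := hs i
      rw [sideFlow, dif_pos i.2] at this
      exact this
    · simp only [flowOfMatrix, Sum.elim_inr]
      split_ifs with h
      · rfl
      · obtain rfl : i = Fin.last n := Fin.ext (by simp; omega)
        rw [rootFlow, dif_pos (Nat.lt_succ_self n)] at hr
        exact sum_eq_zero_iff.mp hr a (mem_univ a)

theorem isPSFlow_iff {n k : ℕ} [NeZero n] (hn : 2 ≤ n) (b : PSkEdge n k → ℕ) :
    IsPSFlow b ↔ IsDominating (rootMatrix b) ∧ b = flowOfMatrix (rootMatrix b) := by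
  have hside : ∀ t, n - 1 ≤ t → sideFlow b t = 0 := fun t ht => dif_neg (by omega)
  have hdom : (∀ j < n, j ≤ partialSum (rootMatrix b) j) ↔
      ∀ j < n, j ≤ ∑ t ∈ range j, rootFlow b t :=
    forall₂_congr fun j hj => by rw [partialSum_rootMatrix b hj.le]
  rw [isPSFlow_iff_conservation hn, conservation_iff_partial_sums, eq_flowOfMatrix_iff, IsDominating,
    ← partialSum_self, partialSum_rootMatrix b le_rfl, hdom]
  constructor
  · rintro ⟨hx, h⟩
    obtain ⟨h1, h2, h3, h4⟩ := (partial_sums_iff_dominating hn _ _ _ hside hx).mp h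
    rw [sum_range_succ, h2, add_zero] at hx
    exact ⟨⟨hx, h3⟩, h1, h2, h4⟩
  · rintro ⟨⟨hx, h3⟩, h1, h2, h4⟩
    have hx' : ∑ t ∈ range (n + 1), rootFlow b t = n - 1 := by
      rw [sum_range_succ, h2, add_zero, hx]
    exact ⟨hx', (partial_sums_iff_dominating hn _ _ _ hside hx').mpr ⟨h1, h2, h3, h4⟩⟩

theorem kostant_eq_card_isDominating (n k : ℕ) [NeZero n] (hn : 2 ≤ n) :
    kostant (psSrc n k) (psTgt n k) (n + 1) (psFlow n) =
      Nat.card {c : Fin k × Fin n → ℕ // IsDominating c} :=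
  Nat.card_congr (α := {b : PSkEdge n k → ℕ // IsPSFlow b})
    { toFun := fun b => ⟨rootMatrix b.1, ((isPSFlow_iff hn b.1).mp b.2).1⟩
      invFun := fun c => ⟨flowOfMatrix c.1, (isPSFlow_iff hn _).mpr (by
        rw [rootMatrix_flowOfMatrix]
        exact ⟨c.2, rfl⟩)⟩
      left_inv := fun b => Subtype.ext ((isPSFlow_iff hn b.1).mp b.2).2.symm
      right_inv := fun c => Subtype.ext (rootMatrix_flowOfMatrix c.1) }

theorem stmt0 (n k : ℕ) (hn : 2 ≤ n) (hk : 1 ≤ k) :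
    (k * n - 1) * kostant (psSrc n k) (psTgt n k) (n + 1) (psFlow n)
      = Nat.choose ((k + 1) * n - 2) n := by
  have : NeZero n := ⟨by omega⟩
  have hcount := mul_card_isDominating n k
  rw [card_fun_sum_eq, ← kostant_eq_card_isDominating n k hn, Fintype.card_prod, Fintype.card_fin,
    Fintype.card_fin] at hcount
  have hkn : n ≤ k * n := Nat.le_mul_of_pos_left n hk
  have hchoose := Nat.choose_succ_right_eq (k * n + (n - 1) - 1) (n - 1)
  rw [Nat.sub_add_cancel (by omega), ← hcount,
    show k * n + (n - 1) - 1 - (n - 1) = k * n - 1 by omega,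
    show k * n + (n - 1) - 1 = (k + 1) * n - 2 by rw [add_one_mul]; omega] at hchoose
  refine Nat.eq_of_mul_eq_mul_left (show 0 < n by omega) ?_
  linarith
end

section
/- Let n ≥ 3 and k ≥ 1 be integers, and let H = Car_{n+1}^{(k)}, a multigraph on vertices {0, 1, …, n+1}. Let K denote the Kostant partition function of H evaluated at the net flow vector that assigns 2n−4 to vertex 0, 2−n to vertex 1, −1 to each of the vertices 2, 3, …, n−1, and 0 to vertex n. Then (kn + n − 3) · K = binom(kn + 2n − 5, n − 1) · binom(n + k − 3, k − 1). Equivalently, the Ehrhart-like polynomial of the caracol graph satisfies E_{Car_{n+1}}(k) = (1/(kn+n−3)) · binom(kn+2n−5, n−1) · binom(n+k−3, k−1). -/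
/-- Edge index type of `Car_{n+1}^{(k)}`: path edges `(i,i+1)` for `1 ≤ i ≤ n`,
source edges `(1,i)` for `3 ≤ i ≤ n`, sink edges `(i,n+1)` for `2 ≤ i ≤ n-1`,
and `k` parallel edges `(0,i)` for each `1 ≤ i ≤ n+1`. -/
abbrev CarkEdge (n k : ℕ) : Type := Fin n ⊕ Fin (n - 2) ⊕ Fin (n - 2) ⊕ Fin k × Fin (n + 1)

def carSrc (n k : ℕ) : CarkEdge n k → ℕ :=
  Sum.elim (fun i => (i : ℕ) + 1)
    (Sum.elim (fun _ => 1) (Sum.elim (fun i => (i : ℕ) + 2) (fun _ => 0)))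

def carTgt (n k : ℕ) : CarkEdge n k → ℕ :=
  Sum.elim (fun i => (i : ℕ) + 2)
    (Sum.elim (fun i => (i : ℕ) + 3) (Sum.elim (fun _ => n + 1) (fun e => (e.2 : ℕ) + 1)))

/-- The net flow vector assigning `2n-4` to vertex `0`, `2-n` to vertex `1`,
`-1` to vertices `2,…,n-1`, and `0` to vertex `n`. -/
def carFlow (n : ℕ) : ℕ → ℤ :=
  fun v => if v = 0 then 2 * (n : ℤ) - 4 else if v = 1 then 2 - (n : ℤ)
    else if v ≤ n - 1 then -1 else 0


theorem sum_ite_val_add_eq {N : ℕ} (c v : ℕ) (f : Fin N → ℤ) :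
    ∑ i : Fin N, (if (i : ℕ) + c = v then f i else 0) =
      if h : c ≤ v ∧ v - c < N then f ⟨v - c, h.2⟩ else 0 := by
  split_ifs with h
  · rw [Finset.sum_eq_single ⟨v - c, h.2⟩]
    · rw [if_pos]
      simp only
      omega
    · intro i _ hi
      rw [if_neg]
      intro h'
      exact hi (Fin.ext (by simp only; omega))
    · simp
  · exact Finset.sum_eq_zero fun i _ => if_neg fun h' => h ⟨by omega, by have := i.2; omega⟩

/-- The number of units entering vertex `j + 2` of the caracol graph from the vertices `0` and `1`. -/
def carInflow {m k : ℕ} (b : CarkEdge (m + 2) k → ℕ) (j : Fin (m + 1)) : (Fin k → ℕ) × ℕ :=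
  (fun l => b (.inr (.inr (.inr (l, j.succ.castSucc)))),
    Fin.cases (b (.inl 0)) (fun i : Fin m => b (.inr (.inl i))) j)

theorem isFlow_iff (m k : ℕ) (hm : 1 ≤ m) (b : CarkEdge (m + 2) k → ℕ) :
    (∀ v < m + 2 + 1, ((∑ e, if carSrc (m + 2) k e = v then (b e : ℤ) else 0) -
      (∑ e, if carTgt (m + 2) k e = v then (b e : ℤ) else 0)) = carFlow (m + 2) v) ↔
    ∑ l : Fin k, ∑ i : Fin (m + 3), b (.inr (.inr (.inr (l, i)))) = 2 * m ∧
    b (.inl 0) + ∑ i : Fin m, b (.inr (.inl i)) + m = ∑ l, b (.inr (.inr (.inr (l, 0)))) ∧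
    (∀ j (h : j < m), b (.inl ⟨j + 1, by omega⟩) + b (.inr (.inr (.inl ⟨j, h⟩))) + 1 =
      (if 0 < j then b (.inl ⟨j, by omega⟩) else 0) +
        (∑ l, (carInflow b ⟨j, by omega⟩).1 l + (carInflow b ⟨j, by omega⟩).2)) ∧
    b (.inl ⟨m + 1, by omega⟩) = b (.inl ⟨m, by omega⟩) +
      (∑ l, (carInflow b ⟨m, by omega⟩).1 l + (carInflow b ⟨m, by omega⟩).2) := by
  have hs : ∀ f : CarkEdge (m + 2) k → ℤ, ∑ e, f e = ∑ i : Fin (m + 2), f (.inl i) +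
      (∑ i : Fin m, f (.inr (.inl i)) + (∑ i : Fin m, f (.inr (.inr (.inl i))) +
        ∑ l : Fin k, ∑ i : Fin (m + 3), f (.inr (.inr (.inr (l, i)))))) := fun f => by
    rw [Fintype.sum_sum_type, Fintype.sum_sum_type, Fintype.sum_sum_type, Fintype.sum_prod_type]
    rfl
  have hsrc : ∀ v, (∑ e, if carSrc (m + 2) k e = v then (b e : ℤ) else 0) =
      (if h : 1 ≤ v ∧ v - 1 < m + 2 then (b (.inl ⟨v - 1, h.2⟩) : ℤ) else 0) +
      ((if 1 = v then ∑ i : Fin m, (b (.inr (.inl i)) : ℤ) else 0) +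
      ((if h : 2 ≤ v ∧ v - 2 < m then (b (.inr (.inr (.inl ⟨v - 2, h.2⟩))) : ℤ) else 0) +
      (if 0 = v then ∑ l, ∑ i, (b (.inr (.inr (.inr (l, i)))) : ℤ) else 0))) := fun v => by
    rw [hs, ← sum_ite_val_add_eq 1 v (fun i => (b (.inl i) : ℤ)),
      ← sum_ite_val_add_eq 2 v (fun i : Fin m => (b (.inr (.inr (.inl i))) : ℤ))]
    congr 2
    · change ∑ i : Fin m, (if 1 = v then (b (.inr (.inl i)) : ℤ) else 0) = _
      split_ifs <;> simp
    · congr 1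
      change ∑ l : Fin k, ∑ i : Fin (m + 3),
        (if 0 = v then (b (.inr (.inr (.inr (l, i)))) : ℤ) else 0) = _
      split_ifs <;> simp
  have htgt : ∀ v, (∑ e, if carTgt (m + 2) k e = v then (b e : ℤ) else 0) =
      (if h : 2 ≤ v ∧ v - 2 < m + 2 then (b (.inl ⟨v - 2, h.2⟩) : ℤ) else 0) +
      ((if h : 3 ≤ v ∧ v - 3 < m then (b (.inr (.inl ⟨v - 3, h.2⟩)) : ℤ) else 0) +
      ((if m + 3 = v then ∑ i : Fin m, (b (.inr (.inr (.inl i))) : ℤ) else 0) +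
      (∑ l, if h : 1 ≤ v ∧ v - 1 < m + 3 then
        (b (.inr (.inr (.inr (l, ⟨v - 1, h.2⟩)))) : ℤ) else 0))) := fun v => by
    have hx := fun l => sum_ite_val_add_eq 1 v
      (fun i : Fin (m + 3) => (b (.inr (.inr (.inr (l, i)))) : ℤ))
    simp only [← hx]
    rw [hs, ← sum_ite_val_add_eq 2 v (fun i => (b (.inl i) : ℤ)),
      ← sum_ite_val_add_eq 3 v (fun i : Fin m => (b (.inr (.inl i)) : ℤ))]
    congr 3
    change ∑ i : Fin m, (if m + 3 = v then (b (.inr (.inr (.inl i))) : ℤ) else 0) = _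
    split_ifs <;> simp
  have e0 : ((∑ e, if carSrc (m + 2) k e = 0 then (b e : ℤ) else 0) -
      (∑ e, if carTgt (m + 2) k e = 0 then (b e : ℤ) else 0)) = carFlow (m + 2) 0 ↔
      ∑ l : Fin k, ∑ i : Fin (m + 3), b (.inr (.inr (.inr (l, i)))) = 2 * m := by
    rw [hsrc, htgt]
    refine Iff.trans ?_ (Nat.cast_inj (R := ℤ))
    simp [carFlow]
    ring_nf
  have e1 : ((∑ e, if carSrc (m + 2) k e = 1 then (b e : ℤ) else 0) -
      (∑ e, if carTgt (m + 2) k e = 1 then (b e : ℤ) else 0)) = carFlow (m + 2) 1 ↔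
      b (.inl 0) + ∑ i : Fin m, b (.inr (.inl i)) + m =
        ∑ l, b (.inr (.inr (.inr (l, 0)))) := by
    rw [hsrc, htgt]
    refine Iff.trans ?_ (Nat.cast_inj (R := ℤ))
    simp [carFlow]
    constructor <;> intro h <;> linarith
  have e2 : ∀ j (h : j < m), ((∑ e, if carSrc (m + 2) k e = j + 2 then (b e : ℤ) else 0) -
      (∑ e, if carTgt (m + 2) k e = j + 2 then (b e : ℤ) else 0)) = carFlow (m + 2) (j + 2) ↔
      b (.inl ⟨j + 1, by omega⟩) + b (.inr (.inr (.inl ⟨j, h⟩))) + 1 =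
      (if 0 < j then b (.inl ⟨j, by omega⟩) else 0) +
        (∑ l, (carInflow b ⟨j, by omega⟩).1 l + (carInflow b ⟨j, by omega⟩).2) := by
    intro j h
    rw [hsrc, htgt]
    refine Iff.trans ?_ (Nat.cast_inj (R := ℤ))
    have hj : j ≤ m - 1 := by omega
    have hm' : 0 < m := hm
    rcases j with _ | j
    · simp [carFlow, carInflow]
      rw [dif_pos hm', if_pos hm]
      constructor <;> intro h <;> linarith
    · simp [carFlow, carInflow]
      rw [dif_pos (by omega), dif_pos h, dif_pos (by omega), dif_pos (by omega),
        if_neg (by omega), dif_pos (by omega), if_pos (by omega)]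
      constructor <;> intro h <;> linarith
  have e3 : ((∑ e, if carSrc (m + 2) k e = m + 2 then (b e : ℤ) else 0) -
      (∑ e, if carTgt (m + 2) k e = m + 2 then (b e : ℤ) else 0)) = carFlow (m + 2) (m + 2) ↔
      b (.inl ⟨m + 1, by omega⟩) = b (.inl ⟨m, by omega⟩) +
      (∑ l, (carInflow b ⟨m, by omega⟩).1 l + (carInflow b ⟨m, by omega⟩).2) := by
    rw [hsrc, htgt]
    refine Iff.trans ?_ (Nat.cast_inj (R := ℤ))
    obtain ⟨m, rfl⟩ : ∃ l, m = l + 1 := ⟨m - 1, by omega⟩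
    simp [carFlow, carInflow]
    constructor <;> intro h <;> linarith
  rw [← e0, ← e1, ← e3]
  constructor
  · intro h
    exact ⟨h _ (by omega), h _ (by omega), fun j hj => (e2 j hj).1 (h _ (by omega)),
      h _ (by omega)⟩
  · rintro ⟨h0, h1, h2, h3⟩ v hv
    obtain rfl | rfl | ⟨j, hj, rfl⟩ | rfl :
        v = 0 ∨ v = 1 ∨ (∃ j, j < m ∧ v = j + 2) ∨ v = m + 2 := by
      by_cases v < 2
      · omega
      · by_cases v = m + 2
        · omega
        · exact .inr (.inr (.inl ⟨v - 2, by omega, by omega⟩))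
    exacts [h0, h1, (e2 j hj).2 (h2 j hj), h3]

/-- The total number of units recorded by an inflow. -/
def inflowSize {k : ℕ} (t : (Fin k → ℕ) × ℕ) : ℕ := ∑ l, t.1 l + t.2

theorem queue_eq {m : ℕ} {T R Q : ℕ → ℕ}
    (h : ∀ j < m, R (j + 1) + Q j + 1 = (if 0 < j then R j else 0) + T j) :
    ∀ j < m, R (j + 1) + ∑ i ∈ Finset.range (j + 1), Q i + (j + 1) =
      ∑ i ∈ Finset.range (j + 1), T i := by
  intro j hj
  induction j with
  | zero => simpa using h 0 hj
  | succ j ih =>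
    have h1 := ih (by omega)
    have h2 := h (j + 1) hj
    rw [if_pos (Nat.succ_pos j)] at h2
    rw [Finset.sum_range_succ Q, Finset.sum_range_succ T]
    omega

theorem natCast_zmod_eq_mk {m j : ℕ} (h : j < m + 1) :
    (j : ZMod (m + 1)) = (⟨j, h⟩ : Fin (m + 1)) :=
  Fin.ext (ZMod.val_natCast_of_lt h)

theorem isFlow_iff_inflow (m k : ℕ) (hm : 1 ≤ m) (b : CarkEdge (m + 2) k → ℕ) :
    (∀ v < m + 2 + 1, ((∑ e, if carSrc (m + 2) k e = v then (b e : ℤ) else 0) -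
      (∑ e, if carTgt (m + 2) k e = v then (b e : ℤ) else 0)) = carFlow (m + 2) v) ↔
    (∑ l, b (.inr (.inr (.inr (l, 0)))) = m + ∑ i, (carInflow b i).2 ∧
      ∑ i, inflowSize (carInflow b i) = m ∧
      ∀ j ≤ m, j ≤ ∑ i ∈ Finset.range j, inflowSize (carInflow b (i : ZMod (m + 1)))) ∧
    (∀ l, b (.inr (.inr (.inr (l, Fin.last _)))) = 0) ∧
    (∀ i : Fin m, b (.inr (.inr (.inl i))) = 0) ∧
    ∀ i : Fin (m + 1), b (.inl i.succ) =
      ∑ j ∈ Finset.range (i + 1), inflowSize (carInflow b (j : ZMod (m + 1))) - (i + 1) := by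
  rw [isFlow_iff m k hm]
  set T : ℕ → ℕ := fun j => inflowSize (carInflow b (j : ZMod (m + 1))) with hTdef
  have hT : ∀ j (h : j < m + 1), inflowSize (carInflow b ⟨j, h⟩) = T j := fun j h => by
    simp only [hTdef, natCast_zmod_eq_mk h]
  have hT' : ∀ j (h : j < m + 1),
      ∑ l, (carInflow b ⟨j, h⟩).1 l + (carInflow b ⟨j, h⟩).2 = T j := hT
  have hTsum : ∑ i, inflowSize (carInflow b i) = ∑ j ∈ Finset.range (m + 1), T j := by
    rw [← Fin.sum_univ_eq_sum_range]
    exact Finset.sum_congr rfl fun i _ => hT i i.2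
  have hY : ∑ i, (carInflow b i).2 = b (.inl 0) + ∑ i : Fin m, b (.inr (.inl i)) := by
    rw [Fin.sum_univ_succ]
    rfl
  have hX : ∑ l : Fin k, ∑ i : Fin (m + 3), b (.inr (.inr (.inr (l, i)))) +
      ∑ i, (carInflow b i).2 = ∑ l, b (.inr (.inr (.inr (l, 0)))) +
        ∑ i, inflowSize (carInflow b i) + ∑ l, b (.inr (.inr (.inr (l, Fin.last _)))) := by
    have h1 : ∑ i, inflowSize (carInflow b i) =
        ∑ l, ∑ i : Fin (m + 1), b (.inr (.inr (.inr (l, i.succ.castSucc)))) +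
          ∑ i, (carInflow b i).2 := by
      rw [Finset.sum_comm, ← Finset.sum_add_distrib]
      rfl
    have h2 : ∀ l, ∑ i : Fin (m + 3), b (.inr (.inr (.inr (l, i)))) =
        b (.inr (.inr (.inr (l, 0)))) +
          ∑ i : Fin (m + 1), b (.inr (.inr (.inr (l, i.succ.castSucc)))) +
          b (.inr (.inr (.inr (l, Fin.last _)))) := fun l => by
      rw [Fin.sum_univ_castSucc, Fin.sum_univ_succ]
      rfl
    simp only [h2, Finset.sum_add_distrib]
    omega
  simp only [hT']
  rw [hTsum] at hX ⊢
  let R : ℕ → ℕ := fun j => if h : j < m + 2 then b (.inl ⟨j, h⟩) else 0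
  let Q : ℕ → ℕ := fun j => if h : j < m then b (.inr (.inr (.inl ⟨j, h⟩))) else 0
  have hR : ∀ j (h : j < m + 2), b (.inl ⟨j, h⟩) = R j := fun j h => by simp only [R, dif_pos h]
  have hQ : ∀ j (h : j < m), b (.inr (.inr (.inl ⟨j, h⟩))) = Q j := fun j h => by
    simp only [Q, dif_pos h]
  have hRs : ∀ i : Fin (m + 1), b (.inl i.succ) = R (i + 1) := fun i => hR (i + 1) (by omega)
  have hQs : ∀ i : Fin m, b (.inr (.inr (.inl i))) = Q i := fun i => hQ i i.2
  have htot := Finset.sum_range_succ T m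
  simp only [hRs, hQs, hR] at hY ⊢
  eta_reduce at *
  constructor
  · rintro ⟨hA, hB, hC, hD⟩
    have key := queue_eq hC
    eta_reduce at key
    have hlast := key (m - 1) (by omega)
    rw [Nat.sub_add_cancel hm] at hlast
    have hQ0 : (Finset.range m).sum Q = 0 := by omega
    have hz : ∑ l, b (.inr (.inr (.inr (l, Fin.last _)))) = 0 := by omega
    have hQ1 : ∀ i < m, Q i = 0 := fun i hi =>
      Finset.sum_eq_zero_iff.mp hQ0 i (Finset.mem_range.mpr hi)
    have hQ2 : ∀ j < m, (Finset.range (j + 1)).sum Q = 0 := fun j hj =>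
      Finset.sum_eq_zero fun i hi => hQ1 i (by have := Finset.mem_range.mp hi; omega)
    refine ⟨⟨by omega, by omega, fun j hj => ?_⟩,
      fun l => Finset.sum_eq_zero_iff.mp hz l (Finset.mem_univ _), fun i => hQ1 i i.2, ?_⟩
    · rcases j with _ | j
      · simp
      · have := key j (by omega)
        omega
    · rintro ⟨i, hi⟩
      simp only
      rcases Nat.lt_succ_iff_lt_or_eq.mp hi with h | rfl
      · have := key i h
        have := hQ2 i h
        omega
      · omega
  · rintro ⟨⟨hc, hs, hg⟩, hz, hq, hr⟩
    have hz' := Finset.sum_eq_zero fun l (_ : l ∈ Finset.univ) => hz l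
    have hr' : ∀ i < m + 1, R (i + 1) = ∑ j ∈ Finset.range (i + 1), T j - (i + 1) :=
      fun i hi => hr ⟨i, hi⟩
    eta_reduce at hr'
    refine ⟨by omega, by omega, fun j hj => ?_, ?_⟩
    · have hq0 : Q j = 0 := hq ⟨j, hj⟩
      have h1 := hr' j (by omega)
      have h2 := hg (j + 1) (by omega)
      have h3 := Finset.sum_range_succ T j
      eta_reduce at h1 h3
      split_ifs with h0
      · have h4 := hr' (j - 1) (by omega)
        have h5 := hg j (by omega)
        rw [Nat.sub_add_cancel h0] at h4
        omega
      · obtain rfl : j = 0 := by omega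
        have h4 : (Finset.range (0 + 1)).sum T = T 0 := by simp
        omega
    · have h1 := hr' m (by omega)
      have h2 := hr' (m - 1) (by omega)
      have h3 := hg m le_rfl
      rw [Nat.sub_add_cancel hm] at h2
      omega

/-- The flow on `Car_{n+1}^{(k)}` determined by its inflows. -/
def flowOfInflow {m k : ℕ} (p : (Fin k → ℕ) × (ZMod (m + 1) → (Fin k → ℕ) × ℕ)) :
    CarkEdge (m + 2) k → ℕ :=
  Sum.elim
    (Fin.cases (p.2 0).2 fun i : Fin (m + 1) =>
      ∑ j ∈ Finset.range (i + 1), inflowSize (p.2 (j : ZMod (m + 1))) - (i + 1))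
    (Sum.elim (fun i : Fin m => (p.2 (i.succ : Fin (m + 1))).2)
      (Sum.elim (fun _ => 0) (fun e => Fin.cases (motive := fun _ => ℕ) (p.1 e.1)
        (fun j : Fin (m + 2) => Fin.lastCases (motive := fun _ => ℕ) 0
          (fun i : Fin (m + 1) => (p.2 i).1 e.1) j) e.2)))

theorem carInflow_flowOfInflow {m k : ℕ}
    (p : (Fin k → ℕ) × (ZMod (m + 1) → (Fin k → ℕ) × ℕ)) : carInflow (flowOfInflow p) = p.2 := by
  funext j
  refine Prod.ext (funext fun l => ?_) ?_
  · simp only [carInflow, flowOfInflow, Sum.elim_inr, ← Fin.succ_castSucc, Fin.cases_succ,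
      Fin.lastCases_castSucc]
  · refine Fin.cases ?_ (fun i => ?_) j <;> rfl

theorem kostant_eq (m k : ℕ) (hm : 1 ≤ m) :
    kostant (carSrc (m + 2) k) (carTgt (m + 2) k) (m + 2 + 1) (carFlow (m + 2)) =
      Nat.card {p : (Fin k → ℕ) × (ZMod (m + 1) → (Fin k → ℕ) × ℕ) //
        ∑ l, p.1 l = m + ∑ i, (p.2 i).2 ∧ ∑ i, inflowSize (p.2 i) = m ∧
          ∀ j ≤ m, j ≤ ∑ i ∈ Finset.range j, inflowSize (p.2 i)} := by
  refine Nat.card_congr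
    { toFun := fun b => ⟨(fun l => b.1 (.inr (.inr (.inr (l, 0)))), carInflow b.1),
        ((isFlow_iff_inflow m k hm b.1).1 b.2).1⟩
      invFun := fun p => ⟨flowOfInflow p.1, (isFlow_iff_inflow m k hm _).2 ?_⟩
      left_inv := ?_
      right_inv := ?_ }
  · rw [carInflow_flowOfInflow]
    refine ⟨p.2, fun l => ?_, fun _ => rfl, fun _ => rfl⟩
    simp only [flowOfInflow, Sum.elim_inr]
    rw [← Fin.succ_last, Fin.cases_succ, Fin.lastCases_last]
  · rintro ⟨b, hb⟩
    obtain ⟨-, hz, hq, hr⟩ := (isFlow_iff_inflow m k hm b).1 hb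
    refine Subtype.ext (funext fun e => ?_)
    rcases e with i | i | i | ⟨l, i⟩
    · refine Fin.cases rfl (fun i => ?_) i
      exact (hr i).symm
    · rfl
    · exact (hq i).symm
    · refine Fin.cases rfl (fun i => ?_) i
      refine Fin.lastCases ?_ (fun i => ?_) i
      · simp only [flowOfInflow, Sum.elim_inr, Fin.cases_succ, Fin.lastCases_last]
        exact (hz l).symm
      · simp only [flowOfInflow, Sum.elim_inr, Fin.cases_succ, Fin.lastCases_castSucc]
        rfl
  · rintro ⟨p, hp⟩
    exact Subtype.ext (Prod.ext rfl (carInflow_flowOfInflow p))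

theorem finite_sum_eq (ι : Type) [Fintype ι] (s : ℕ) : Finite {f : ι → ℕ // ∑ i, f i = s} := by
  classical
  exact Finite.of_equiv _ (Sym.equivNatSumOfFintype ι s)

theorem card_sum_eq (ι : Type) [Fintype ι] (s : ℕ) :
    Nat.card {f : ι → ℕ // ∑ i, f i = s} = (Fintype.card ι).multichoose s := by
  classical
  rw [← Nat.card_congr (Sym.equivNatSumOfFintype ι s), Nat.card_eq_fintype_card,
    Sym.card_sym_eq_multichoose]

theorem card_add_eq {A B : Type} (u : A → ℕ) (v : B → ℕ)
    [∀ s, Finite {a // u a = s}] [∀ s, Finite {b // v b = s}] (m : ℕ) :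
    Nat.card {p : A × B // u p.1 + v p.2 = m} =
      ∑ s ∈ Finset.range (m + 1), Nat.card {a // u a = s} * Nat.card {b // v b = m - s} := by
  let e : {p : A × B // u p.1 + v p.2 = m} ≃
      Σ s : Fin (m + 1), {a // u a = s} × {b // v b = m - s} :=
    { toFun := fun p => ⟨⟨u p.1.1, by have := p.2; omega⟩, ⟨p.1.1, rfl⟩,
        ⟨p.1.2, by have := p.2; simp only; omega⟩⟩
      invFun := fun q => ⟨(q.2.1.1, q.2.2.1), by
        have h1 := q.2.1.2; have h2 := q.2.2.2; have := q.1.2; simp only; omega⟩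
      left_inv := fun p => rfl
      right_inv := by
        rintro ⟨⟨s, hs⟩, ⟨a, ha⟩, ⟨b, hb⟩⟩
        simp only at ha
        subst ha
        rfl }
  rw [Nat.card_congr e, Nat.card_sigma, ← Fin.sum_univ_eq_sum_range
    (fun s => Nat.card {a // u a = s} * Nat.card {b // v b = m - s})]
  simp only [Nat.card_prod]

theorem multichoose_add (a b m : ℕ) :
    (a + b).multichoose m =
      ∑ s ∈ Finset.range (m + 1), a.multichoose s * b.multichoose (m - s) := by
  have hA := finite_sum_eq (Fin a)
  have hB := finite_sum_eq (Fin b)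
  have h := card_add_eq (fun f : Fin a → ℕ => ∑ i, f i) (fun f : Fin b → ℕ => ∑ i, f i) m
  simp only [card_sum_eq, Fintype.card_fin] at h
  rw [← h]
  have h2 := card_sum_eq (Fin a ⊕ Fin b) m
  simp only [Fintype.card_sum, Fintype.card_fin] at h2
  rw [← h2]
  refine Nat.card_congr ((Equiv.sumArrowEquivProdArrow _ _ _).subtypeEquiv fun f => ?_)
  simp [Equiv.sumArrowEquivProdArrow]

theorem multichoose_mul_multichoose (k m s : ℕ) (hk : 1 ≤ k) :
    k.multichoose (m + s) * (m + 1).multichoose s =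
      (m + k - 1).choose (k - 1) * (m + k).multichoose s := by
  obtain ⟨k, rfl⟩ : ∃ l, k = l + 1 := ⟨k - 1, by omega⟩
  simp only [Nat.multichoose_eq]
  have e1 : k + 1 + (m + s) - 1 = k + (m + s) := by omega
  have e2 : m + 1 + s - 1 = m + s := by omega
  have e3 : m + (k + 1) - 1 = m + k := by omega
  have e4 : m + (k + 1) + s - 1 = (m + k) + s := by omega
  rw [e1, e2, e3, e4, Nat.add_sub_cancel]
  have h1 := Nat.add_choose_mul_factorial_mul_factorial k (m + s)
  have h2 := Nat.add_choose_mul_factorial_mul_factorial m s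
  have h3 := Nat.add_choose_mul_factorial_mul_factorial m k
  have h4 := Nat.add_choose_mul_factorial_mul_factorial (m + k) s
  have hpos : 0 < k.factorial * m.factorial * s.factorial := by positivity
  refine Nat.eq_of_mul_eq_mul_right hpos ?_
  rw [show m + k + s = k + (m + s) by ring] at h4 ⊢
  calc _ = (k + (m + s)).choose (m + s) * k.factorial *
        ((m + s).choose s * m.factorial * s.factorial) := by ring
    _ = (k + (m + s)).choose s * ((m + k).choose k * m.factorial * k.factorial) *
        s.factorial := by rw [h2, h1, h3, h4]
    _ = _ := by ring

open Finset in
theorem cycle_existsUnique (T : ℕ → ℕ) (m : ℕ) (hper : ∀ i, T (i + (m + 1)) = T i)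
    (hsum : ∑ i ∈ range (m + 1), T i = m) :
    ∃! r, r < m + 1 ∧ ∀ j ≤ m, j ≤ ∑ i ∈ range j, T (r + i) := by
  set S : ℕ → ℤ := fun i => (∑ l ∈ range i, (T l : ℤ)) - i with hS
  have hSper : ∀ i, S (i + (m + 1)) = S i - 1 := by
    intro i
    induction i with
    | zero =>
      have : (∑ i ∈ range (m + 1), (T i : ℤ)) = m := by exact_mod_cast hsum
      simp only [hS, zero_add, this]
      simp
    | succ i ih =>
      simp only [hS] at ih ⊢
      rw [show i + 1 + (m + 1) = (i + (m + 1)) + 1 by ring, sum_range_succ, hper, sum_range_succ]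
      push_cast at ih ⊢
      linarith
  have hkey : ∀ r j, (j ≤ ∑ i ∈ range j, T (r + i)) ↔ S r ≤ S (r + j) := by
    intro r j
    simp only [hS, sum_range_add]
    rw [← Nat.cast_le (α := ℤ)]
    push_cast
    constructor <;> intro h <;> linarith
  simp only [hkey]
  obtain ⟨r, hr, hmin⟩ : ∃ r < m + 1, (∀ i < m + 1, S r ≤ S i) ∧ ∀ i < r, S r < S i := by
    have hex : ∃ r, r < m + 1 ∧ ∀ i < m + 1, S r ≤ S i := by
      obtain ⟨r, hr, h⟩ := (range (m + 1)).exists_min_image S ⟨0, by simp⟩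
      exact ⟨r, by simpa using hr, fun i hi => h i (by simpa using hi)⟩
    classical
    refine ⟨Nat.find hex, (Nat.find_spec hex).1, (Nat.find_spec hex).2, fun i hi => ?_⟩
    have h := Nat.find_min hex hi
    have h1 := Nat.find_spec hex
    by_contra hc
    exact h ⟨by omega, fun l hl => (not_lt.mp hc).trans (h1.2 l hl)⟩
  refine ⟨r, ⟨hr, fun j hj => ?_⟩, ?_⟩
  · rcases lt_or_ge (r + j) (m + 1) with h | h
    · exact hmin.1 _ h
    · obtain ⟨i, hi⟩ := Nat.exists_eq_add_of_le' h
      have := hmin.2 i (by omega)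
      rw [hi, hSper]
      omega
  · have aux : ∀ r r', r < r' → r' < m + 1 → (∀ j ≤ m, S r ≤ S (r + j)) →
        (∀ j ≤ m, S r' ≤ S (r' + j)) → False := by
      intro r r' h h' h1 h2
      have a := h1 (r' - r) (by omega)
      have b := h2 (m + 1 - (r' - r)) (by omega)
      rw [show r + (r' - r) = r' by omega] at a
      rw [show r' + (m + 1 - (r' - r)) = r + (m + 1) by omega, hSper] at b
      omega
    rintro r' ⟨hr', h'⟩
    have hgood : ∀ j ≤ m, S r ≤ S (r + j) := fun j hj => by
      rcases lt_or_ge (r + j) (m + 1) with h | h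
      · exact hmin.1 _ h
      · obtain ⟨i, hi⟩ := Nat.exists_eq_add_of_le' h
        have := hmin.2 i (by omega)
        rw [hi, hSper]
        omega
    rcases lt_trichotomy r r' with h | h | h
    · exact (aux r r' h hr' hgood h').elim
    · exact h.symm
    · exact (aux r' r h hr h' hgood).elim

theorem card_rotation {α β : Type} (w : α → ℕ) (m : ℕ) (Q : β → (ZMod (m + 1) → α) → Prop)
    (hQ : ∀ c a r, Q c (fun i => a (r + i)) ↔ Q c a) :
    (m + 1) * Nat.card {p : β × (ZMod (m + 1) → α) // Q p.1 p.2 ∧ ∑ i, w (p.2 i) = m ∧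
        ∀ j ≤ m, j ≤ ∑ i ∈ Finset.range j, w (p.2 i)} =
      Nat.card {p : β × (ZMod (m + 1) → α) // Q p.1 p.2 ∧ ∑ i, w (p.2 i) = m} := by
  have hsum : ∀ (a : ZMod (m + 1) → α) r, ∑ i, w (a (r + i)) = ∑ i, w (a i) := fun a r =>
    Equiv.sum_comp (Equiv.addLeft r) fun i => w (a i)
  have hrot : ∀ a : ZMod (m + 1) → α, ∑ i, w (a i) = m →
      ∃! r : ZMod (m + 1), ∀ j ≤ m, j ≤ ∑ i ∈ Finset.range j, w (a (r + i)) := by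
    intro a ha
    obtain ⟨r, ⟨hr, h⟩, huniq⟩ := cycle_existsUnique (fun i => w (a (i : ZMod (m + 1)))) m
      (fun i => by congr 2; have := ZMod.natCast_self (m + 1); rw [Nat.cast_add, this, add_zero])
      (by
        refine Eq.trans ?_ ha
        rw [← Fin.sum_univ_eq_sum_range (fun i => w (a (i : ZMod (m + 1))))]
        refine Finset.sum_congr rfl fun i _ => ?_
        congr 2
        exact ZMod.natCast_zmod_val (n := m + 1) i)
    refine ⟨r, by simpa using h, fun r' h' => ?_⟩
    have := huniq r'.val ⟨ZMod.val_lt r', by simpa using h'⟩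
    rw [← this, ZMod.natCast_zmod_val]
  have hcard : m + 1 = Nat.card (ZMod (m + 1)) := by simp
  conv_lhs => enter [1]; rw [hcard]
  rw [← Nat.card_prod]
  refine Nat.card_congr (Equiv.ofBijective (fun q => ⟨(q.2.1.1, fun i => q.2.1.2 (-q.1 + i)),
    (hQ _ _ _).2 q.2.2.1, (hsum _ _).trans q.2.2.2.1⟩) ⟨?_, ?_⟩)
  · rintro ⟨r, ⟨c, g⟩, hq, hs, hg⟩ ⟨r', ⟨c', g'⟩, hq', hs', hg'⟩ h
    simp only [Subtype.mk.injEq, Prod.mk.injEq] at h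
    obtain ⟨rfl, h⟩ := h
    obtain rfl : r = r' := by
      refine (hrot (fun i => g (-r + i)) ((hsum _ _).trans hs)).unique ?_ ?_
      · simpa using hg
      · have h' : ∀ x, g (-r + x) = g' (-r' + x) := congrFun h
        simpa only [h', neg_add_cancel_left] using hg'
    have : g = g' := by
      funext i
      simpa using congrFun h (r + i)
    subst this
    rfl
  · rintro ⟨⟨c, a⟩, hq, hs⟩
    obtain ⟨r, hr, -⟩ := hrot a hs
    refine ⟨⟨r, ⟨(c, fun i => a (r + i)), (hQ _ _ _).2 hq, (hsum _ _).trans hs, hr⟩⟩, ?_⟩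
    simp

theorem card_sequences (m k : ℕ) (hk : 1 ≤ k) :
    Nat.card {p : (Fin k → ℕ) × (ZMod (m + 1) → (Fin k → ℕ) × ℕ) //
      ∑ l, p.1 l = m + ∑ i, (p.2 i).2 ∧ ∑ i, (∑ l, (p.2 i).1 l + (p.2 i).2) = m} =
      (m + k - 1).choose (k - 1) * (m + k + (m + 1) * k).multichoose m := by
  let A := {q : (Fin k → ℕ) × (ZMod (m + 1) → ℕ) // ∑ l, q.1 l = m + ∑ i, q.2 i}
  let u : A → ℕ := fun q => ∑ i, q.1.2 i
  let v : (ZMod (m + 1) × Fin k → ℕ) → ℕ := fun x => ∑ i, x i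
  have hv : ∀ s, Finite {x // v x = s} := finite_sum_eq _
  let eA : ∀ s, {a // u a = s} ≃
      {c : Fin k → ℕ // ∑ l, c l = m + s} × {y : ZMod (m + 1) → ℕ // ∑ i, y i = s} := fun s =>
    { toFun := fun a => ⟨⟨a.1.1.1, a.1.2.trans (congrArg (m + ·) a.2)⟩, ⟨a.1.1.2, a.2⟩⟩
      invFun := fun q => ⟨⟨(q.1.1, q.2.1), by simp only [q.1.2, q.2.2]⟩, q.2.2⟩
      left_inv := fun _ => rfl
      right_inv := fun _ => rfl }
  have hu : ∀ s, Finite {a // u a = s} := fun s => by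
    have := finite_sum_eq (Fin k) (m + s)
    have := finite_sum_eq (ZMod (m + 1)) s
    exact Finite.of_equiv _ (eA s).symm
  have key := card_add_eq u v m
  have h1 : ∀ s, Nat.card {a // u a = s} =
      (m + k - 1).choose (k - 1) * (m + k).multichoose s := fun s => by
    rw [Nat.card_congr (eA s), Nat.card_prod, card_sum_eq, card_sum_eq,
      ← multichoose_mul_multichoose k m s hk]
    simp
  have h2 : ∀ s, Nat.card {x // v x = s} = ((m + 1) * k).multichoose s := fun s =>
    (card_sum_eq _ s).trans (by simp)
  simp only [h1, h2, mul_assoc] at key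
  rw [multichoose_add, Finset.mul_sum, ← key]
  refine Nat.card_congr
    { toFun := fun p => ⟨(⟨(p.1.1, fun i => (p.1.2 i).2), p.2.1⟩, fun z => (p.1.2 z.1).1 z.2), ?_⟩
      invFun := fun q => ⟨(q.1.1.1.1, fun i => (fun l => q.1.2 (i, l), q.1.1.1.2 i)), q.1.1.2, ?_⟩
      left_inv := fun _ => rfl
      right_inv := fun _ => rfl }
  · have := p.2.2
    simp only [u, v, Fintype.sum_prod_type]
    rw [Finset.sum_add_distrib] at this
    omega
  · have := q.2
    simp only [u, v, Fintype.sum_prod_type] at this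
    rw [Finset.sum_add_distrib]
    simp only
    omega

theorem stmt1 (n k : ℕ) (hn : 3 ≤ n) (hk : 1 ≤ k) :
    (k * n + n - 3) * kostant (carSrc n k) (carTgt n k) (n + 1) (carFlow n)
      = Nat.choose (k * n + 2 * n - 5) (n - 1) * Nat.choose (n + k - 3) (k - 1) := by
  obtain ⟨m, rfl⟩ : ∃ m, n = m + 2 := ⟨n - 2, by omega⟩
  have hm : 1 ≤ m := by omega
  have hcount := card_rotation (inflowSize (k := k)) m
    (fun (c : Fin k → ℕ) a => ∑ l, c l = m + ∑ i, (a i).2)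
    (fun c a r => by
      rw [← Equiv.sum_comp (Equiv.addLeft r) fun i => (a i).2]
      rfl)
  have hseq := card_sequences m k hk
  rw [← kostant_eq m k hm] at hcount
  rw [show m + 2 + k - 3 = m + k - 1 by omega]
  set K := kostant (carSrc (m + 2) k) (carTgt (m + 2) k) (m + 2 + 1) (carFlow (m + 2))
  have hK : (m + 1) * K =
      (m + k - 1).choose (k - 1) * (k * (m + 2) + 2 * (m + 2) - 5).choose m := by
    refine (hcount.trans hseq).trans ?_
    rw [Nat.multichoose_eq]
    congr 2
    have : m + k + (m + 1) * k = k * (m + 2) + m := by ring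
    omega
  have hch := Nat.choose_succ_right_eq (k * (m + 2) + 2 * (m + 2) - 5) m
  have hpos : 1 ≤ k * (m + 2) := Nat.mul_pos hk (by omega)
  rw [show k * (m + 2) + 2 * (m + 2) - 5 - m = k * (m + 2) + (m + 2) - 3 by omega] at hch
  refine Nat.eq_of_mul_eq_mul_left (Nat.succ_pos m) ?_
  rw [show m + 2 - 1 = m + 1 by omega]
  calc (m + 1) * ((k * (m + 2) + (m + 2) - 3) * K)
      = (k * (m + 2) + (m + 2) - 3) * ((m + 1) * K) := by ring
    _ = (k * (m + 2) + 2 * (m + 2) - 5).choose m * (k * (m + 2) + (m + 2) - 3) *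
        (m + k - 1).choose (k - 1) := by rw [hK]; ring
    _ = (m + 1) * ((k * (m + 2) + 2 * (m + 2) - 5).choose (m + 1) *
        (m + k - 1).choose (k - 1)) := by rw [← hch]; ring
end

section
/- Let n ≥ 1 and k ≥ 0 be integers and let a_0, a_1, …, a_k be nonnegative integers with a_0 + a_1 + ⋯ + a_k = n. Then (n + 1) · |LD_n(k; a_0, a_1, …, a_k)| = Π_{i=0}^{k} binom(n + a_i, a_i). -/
/-- The relation on letters (`none` = `U`, `some i` = `D_i`) requiring that two
consecutive down-steps have weakly decreasing labels. -/
def DownWeak : Option ℕ → Option ℕ → Prop :=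
  fun x y => ∀ a b, x = some a → y = some b → b ≤ a

/-- `w` is a `k`-labeled Dyck word of length `2n`: a word in the letters
`U` (= `none`) and `D_0,…,D_k` (= `some 0,…,some k`) with exactly `n` `U`'s,
every prefix having at least as many `U`'s as `D`'s, and labels of consecutive
down-steps weakly decreasing. -/
def IsLDWord (n k : ℕ) (w : List (Option ℕ)) : Prop :=
  w.length = 2 * n ∧ w.count none = n ∧
  (∀ x ∈ w, ∀ i, x = some i → i ≤ k) ∧
  (∀ p : List (Option ℕ), p <+: w → p.length ≤ 2 * p.count none) ∧
  w.Chain' DownWeak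

/-- Words with `n` letters `U` and `a i` letters `D_i` satisfying the labeled Dyck conditions,
whose last letter is not `D_b` for any `b < j`. -/
def ldPrefixes (n : ℕ) (a : ℕ → ℕ) (j : ℕ) : Set (List (Option ℕ)) :=
  {w | w.count none = n ∧ (∀ i, w.count (some i) = a i) ∧
    (∀ p : List (Option ℕ), p <+: w → p.length ≤ 2 * p.count none) ∧
    w.IsChain DownWeak ∧ ∀ b, w.getLast? = some (some b) → j ≤ b}

theorem length_eq_count_none_add_sum (K : ℕ) (w : List (Option ℕ))
    (h : ∀ i, some i ∈ w → i < K) :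
    w.length = w.count none + ∑ i ∈ Finset.range K, w.count (some i) := by
  induction w with
  | nil => simp
  | cons x w ih =>
    have ih := ih fun i hi => h i (List.mem_cons_of_mem _ hi)
    cases x with
    | none => simp [ih]; omega
    | some b =>
      have hb : b < K := h b (by simp)
      simp [List.count_cons, Finset.sum_add_distrib, ih, hb]
      omega

theorem length_of_mem_ldPrefixes {n K j : ℕ} {a : ℕ → ℕ} (ha : ∀ i, K ≤ i → a i = 0)
    {w : List (Option ℕ)} (hw : w ∈ ldPrefixes n a j) :
    w.length = n + ∑ i ∈ Finset.range K, a i := by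
  obtain ⟨h1, h2, -⟩ := hw
  rw [length_eq_count_none_add_sum K w, h1]
  · simp [h2]
  · intro i hi
    by_contra! hK
    have := List.count_pos_iff.2 hi
    rw [h2, ha i hK] at this
    omega

theorem ldPrefixes_eq_empty {n K j : ℕ} {a : ℕ → ℕ} (ha : ∀ i, K ≤ i → a i = 0)
    (h : n < ∑ i ∈ Finset.range K, a i) : ldPrefixes n a j = ∅ := by
  ext w
  simp only [Set.mem_empty_iff_false, iff_false]
  intro hw
  have h1 := length_of_mem_ldPrefixes ha hw
  have h2 := hw.2.2.1 w List.prefix_rfl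
  rw [hw.1] at h2
  omega

theorem append_some_mem_ldPrefixes_iff {n K j b : ℕ} {a : ℕ → ℕ}
    (ha : ∀ i, K ≤ i → a i = 0) (hn : ∑ i ∈ Finset.range K, a i + 1 ≤ n) (hb : j ≤ b)
    (hbK : b < K) (w : List (Option ℕ)) :
    w ++ [some b] ∈ ldPrefixes n (Function.update a b (a b + 1)) j ↔ w ∈ ldPrefixes n a b := by
  have hcount : (∀ i, (w ++ [some b]).count (some i) = Function.update a b (a b + 1) i) ↔
      ∀ i, w.count (some i) = a i := by
    refine forall_congr' fun i => ?_
    by_cases hi : i = b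
    · subst hi; simp
    · have : ¬ b = i := fun h => hi h.symm
      simp [Function.update, hi, this]
  have hlast : (w ++ [some b]).IsChain DownWeak ↔
      w.IsChain DownWeak ∧ ∀ c, w.getLast? = some (some c) → b ≤ c := by
    rw [List.isChain_append]
    simp only [List.isChain_singleton, true_and, List.head?_cons, Option.mem_def, DownWeak]
    refine and_congr_right fun _ => ⟨fun h c hc => h _ hc _ rfl _ _ rfl rfl, ?_⟩
    rintro h x hx y hy c d rfl rfl
    simp only [Option.some.injEq] at hy
    subst hy
    exact h _ hx
  constructor
  · rintro ⟨h1, h2, h3, h4, -⟩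
    exact ⟨by simpa using h1, hcount.1 h2, fun p hp => h3 p (hp.trans (List.prefix_append _ _)),
      hlast.1 h4⟩
  · intro hw
    have hlen := length_of_mem_ldPrefixes ha hw
    obtain ⟨h1, h2, h3, h4, h5⟩ := hw
    refine ⟨by simpa using h1, hcount.2 h2, ?_, hlast.2 ⟨h4, h5⟩, ?_⟩
    · intro p hp
      rcases List.prefix_concat_iff.1 hp with rfl | hp
      · simp [h1, hlen]; omega
      · exact h3 p hp
    · intro c hc
      simp at hc
      omega

theorem ldPrefixes_update_succ {n K j : ℕ} {a : ℕ → ℕ} (ha : ∀ i, K ≤ i → a i = 0)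
    (hn : ∑ i ∈ Finset.range K, a i + 1 ≤ n) (hj : j < K) :
    ldPrefixes n (Function.update a j (a j + 1)) j =
      ldPrefixes n (Function.update a j (a j + 1)) (j + 1) ∪
        (fun w => w ++ [some j]) '' ldPrefixes n a j := by
  ext w
  constructor
  · intro hw
    by_cases hl : w.getLast? = some (some j)
    · right
      obtain ⟨v, rfl⟩ := List.getLast?_eq_some_iff.1 hl
      exact ⟨v, (append_some_mem_ldPrefixes_iff ha hn le_rfl hj v).1 hw, rfl⟩
    · left
      obtain ⟨h1, h2, h3, h4, h5⟩ := hw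
      refine ⟨h1, h2, h3, h4, fun b hb => lt_of_le_of_ne (h5 b hb) ?_⟩
      rintro rfl
      exact hl hb
  · rintro (⟨h1, h2, h3, h4, h5⟩ | ⟨v, hv, rfl⟩)
    · exact ⟨h1, h2, h3, h4, fun b hb => (Nat.le_succ j).trans (h5 b hb)⟩
    · exact (append_some_mem_ldPrefixes_iff ha hn le_rfl hj v).2 hv

theorem ldPrefixes_of_eq_zero {n j : ℕ} {a : ℕ → ℕ} (ha : a j = 0) :
    ldPrefixes n a j = ldPrefixes n a (j + 1) := by
  ext w
  refine and_congr_right fun _ => and_congr_right fun h2 => and_congr_right fun _ =>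
    and_congr_right fun _ => forall_congr' fun b => forall_congr' fun hb =>
      ⟨fun h => lt_of_le_of_ne h ?_, fun h => (Nat.le_succ j).trans h⟩
  rintro rfl
  have := List.count_pos_iff.2 (List.mem_of_getLast? hb)
  rw [h2, ha] at this
  omega

theorem ldPrefixes_succ_of_support_le {n K : ℕ} {a : ℕ → ℕ} (ha : ∀ i, K ≤ i → a i = 0) :
    ldPrefixes (n + 1) a K = (fun w => w ++ [none]) '' ldPrefixes n a 0 := by
  ext w
  constructor
  · rintro ⟨h1, h2, h3, h4, h5⟩
    rcases List.eq_nil_or_concat w with rfl | ⟨v, x, rfl⟩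
    · simp at h1
    · rw [List.concat_eq_append] at *
      cases x with
      | none =>
        exact ⟨v, ⟨by simpa using h1, by simpa using h2,
          fun p hp => h3 p (hp.trans (List.prefix_append _ _)),
          (List.isChain_append.1 h4).1, fun _ _ => Nat.zero_le _⟩, rfl⟩
      | some b =>
        have hb := h2 b
        rw [ha b (h5 b (by simp))] at hb
        simp at hb
  · rintro ⟨v, hv, rfl⟩
    have hlen := hv.2.2.1 v List.prefix_rfl
    obtain ⟨h1, h2, h3, h4, -⟩ := hv
    refine ⟨by simpa using h1, by simpa using h2, ?_, ?_, ?_⟩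
    · intro p hp
      rcases List.prefix_concat_iff.1 hp with rfl | hp
      · simp; omega
      · exact h3 p hp
    · rw [List.isChain_append]
      refine ⟨h4, by simp, ?_⟩
      rintro x - y hy c d - rfl
      simp at hy
    · simp

theorem choose_recurrence (n c : ℕ) (A B : ℤ) :
    (((n + 1 + (c + 1)).choose (c + 1) : ℕ) : ℤ) *
        ((n + 1) * (n + 2) - (n + 2) * A - (n + 1) * (c + 1 + B)) =
      ((n + (c + 1)).choose (c + 1) : ℕ) *
        ((n + 1) * (n + 2) - (n + 2) * (A + (c + 1)) - (n + 1) * B) +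
      ((n + 1 + c).choose c : ℕ) *
        ((n + 1) * (n + 2) - (n + 2) * A - (n + 1) * (c + B)) := by
  have h1 : (n + 1 + (c + 1)).choose (c + 1) =
      (n + 1 + c).choose c + (n + (c + 1)).choose (c + 1) := by
    rw [show n + 1 + (c + 1) = (n + 1 + c) + 1 by ring, Nat.choose_succ_succ',
      show n + (c + 1) = n + 1 + c by ring]
  have h2 : (n + (c + 1)).choose (c + 1) * (c + 1) = (n + 1 + c).choose c * (n + 1) := by
    have := Nat.choose_succ_right_eq (n + 1 + c) c
    rw [show n + (c + 1) = n + 1 + c by ring]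
    rwa [show n + 1 + c - c = n + 1 by omega] at this
  zify at h1 h2
  rw [h1]
  linear_combination h2

theorem ncard_ldPrefixes_step {n K : ℕ}
    (ih : ∀ a : ℕ → ℕ, (∀ i, K ≤ i → a i = 0) → ∑ i ∈ Finset.range K, a i ≤ n + 1 →
      (ldPrefixes n a 0).Finite ∧ ((n : ℤ) + 1) * (ldPrefixes n a 0).ncard =
        (n + 1 - ∑ i ∈ Finset.range K, (a i : ℤ)) *
          ∏ i ∈ Finset.range K, ((n + a i).choose (a i) : ℤ))
    {j : ℕ} (hj : j ≤ K) :
    ∀ a : ℕ → ℕ, (∀ i, K ≤ i → a i = 0) → ∑ i ∈ Finset.range K, a i ≤ n + 1 →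
      (ldPrefixes (n + 1) a j).Finite ∧
      ((n : ℤ) + 1) * (n + 2) * (ldPrefixes (n + 1) a j).ncard =
        (∏ i ∈ Finset.range j, ((n + a i).choose (a i) : ℤ)) *
          (∏ i ∈ Finset.Ico j K, ((n + 1 + a i).choose (a i) : ℤ)) *
          ((n + 1) * (n + 2) - (n + 2) * ∑ i ∈ Finset.range j, (a i : ℤ) -
            (n + 1) * ∑ i ∈ Finset.Ico j K, (a i : ℤ)) := by
  induction hj using Nat.decreasingInduction with
  | self =>
    intro a ha hs
    obtain ⟨hf, hc⟩ := ih a ha hs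
    rw [ldPrefixes_succ_of_support_le ha]
    refine ⟨hf.image _, ?_⟩
    rw [Set.ncard_image_of_injective _ (List.append_left_injective _)]
    simp only [Finset.Ico_self, Finset.prod_empty, Finset.sum_empty]
    linear_combination ((n : ℤ) + 2) * hc
  | of_succ j hj ihj =>
    suffices H : ∀ c, ∀ a : ℕ → ℕ, a j = c → (∀ i, K ≤ i → a i = 0) →
        ∑ i ∈ Finset.range K, a i ≤ n + 1 →
        (ldPrefixes (n + 1) a j).Finite ∧
        ((n : ℤ) + 1) * (n + 2) * (ldPrefixes (n + 1) a j).ncard =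
          (∏ i ∈ Finset.range j, ((n + a i).choose (a i) : ℤ)) *
            (∏ i ∈ Finset.Ico j K, ((n + 1 + a i).choose (a i) : ℤ)) *
            ((n + 1) * (n + 2) - (n + 2) * ∑ i ∈ Finset.range j, (a i : ℤ) -
              (n + 1) * ∑ i ∈ Finset.Ico j K, (a i : ℤ)) from
      fun a => H (a j) a rfl
    intro c
    induction c with
    | zero =>
      intro a hc ha hs
      obtain ⟨hf, hcard⟩ := ihj a ha hs
      rw [ldPrefixes_of_eq_zero hc]
      refine ⟨hf, ?_⟩
      rw [hcard, Finset.prod_range_succ, Finset.sum_range_succ,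
        Finset.prod_eq_prod_Ico_succ_bot hj, Finset.sum_eq_sum_Ico_succ_bot hj, hc]
      simp
    | succ c ihc =>
      intro a' hc' ha' hs'
      obtain ⟨a, hc, rfl⟩ : ∃ a : ℕ → ℕ, a j = c ∧ a' = Function.update a j (a j + 1) :=
        ⟨Function.update a' j c, by simp, by simp [← hc']⟩
      have hne : ∀ i, i ≠ j → Function.update a j (a j + 1) i = a i := fun i hi => by simp [hi]
      have ha : ∀ i, K ≤ i → a i = 0 := fun i hi => by
        rw [← hne i (by omega)]; exact ha' i hi
      have hs : ∑ i ∈ Finset.range K, a i + 1 ≤ n + 1 := by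
        have := Finset.sum_update_of_mem (Finset.mem_range.2 hj) a (a j + 1)
        have h2 := Finset.sum_update_of_mem (Finset.mem_range.2 hj) a (a j)
        rw [Function.update_eq_self] at h2
        omega
      obtain ⟨hf1, hc1⟩ := ihj _ ha' hs'
      obtain ⟨hf2, hc2⟩ := ihc a hc ha (by omega)
      rw [ldPrefixes_update_succ ha hs hj]
      refine ⟨hf1.union (hf2.image _), ?_⟩
      rw [Set.ncard_union_eq _ hf1 (hf2.image _),
        Set.ncard_image_of_injective _ (List.append_left_injective _)]
      · push_cast
        rw [mul_add, hc1, hc2]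
        have hr : ∀ i ∈ Finset.range j, Function.update a j (a j + 1) i = a i := fun i hi =>
          hne i (Finset.mem_range.1 hi).ne
        have hI : ∀ i ∈ Finset.Ico (j + 1) K, Function.update a j (a j + 1) i = a i :=
          fun i hi => hne i (by have := Finset.mem_Ico.1 hi; omega)
        rw [Finset.prod_range_succ, Finset.sum_range_succ]
        simp only [Finset.prod_eq_prod_Ico_succ_bot hj, Finset.sum_eq_sum_Ico_succ_bot hj]
        rw [Finset.prod_congr rfl fun i hi => by rw [hr i hi],
          Finset.prod_congr (s₁ := Finset.Ico (j + 1) K) rfl fun i hi => by rw [hI i hi],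
          Finset.sum_congr rfl fun i hi => by rw [hr i hi],
          Finset.sum_congr (s₁ := Finset.Ico (j + 1) K) rfl fun i hi => by rw [hI i hi]]
        simp only [Function.update_self, hc]
        have := choose_recurrence n c (∑ i ∈ Finset.range j, (a i : ℤ))
          (∑ i ∈ Finset.Ico (j + 1) K, (a i : ℤ))
        push_cast at this ⊢
        linear_combination -(∏ i ∈ Finset.range j, ((n + a i).choose (a i) : ℤ)) *
          (∏ i ∈ Finset.Ico (j + 1) K, ((n + 1 + a i).choose (a i) : ℤ)) * this
      · rw [Set.disjoint_left]
        rintro _ hw ⟨v, -, rfl⟩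
        have := hw.2.2.2.2 j (by simp)
        omega

theorem ncard_ldPrefixes (K n : ℕ) : ∀ a : ℕ → ℕ, (∀ i, K ≤ i → a i = 0) →
    ∑ i ∈ Finset.range K, a i ≤ n + 1 →
      (ldPrefixes n a 0).Finite ∧ ((n : ℤ) + 1) * (ldPrefixes n a 0).ncard =
        (n + 1 - ∑ i ∈ Finset.range K, (a i : ℤ)) *
          ∏ i ∈ Finset.range K, ((n + a i).choose (a i) : ℤ) := by
  have htop : ∀ m : ℕ, ∀ a : ℕ → ℕ, (∀ i, K ≤ i → a i = 0) →
      ∑ i ∈ Finset.range K, a i = m + 1 →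
      (ldPrefixes m a 0).Finite ∧ ((m : ℤ) + 1) * (ldPrefixes m a 0).ncard =
        (m + 1 - ∑ i ∈ Finset.range K, (a i : ℤ)) *
          ∏ i ∈ Finset.range K, ((m + a i).choose (a i) : ℤ) := by
    intro m a ha hs
    rw [ldPrefixes_eq_empty ha (by omega), ← Nat.cast_sum, hs]
    simp
  induction n with
  | zero =>
    intro a ha hs
    rcases hs.lt_or_eq with hs | hs
    · have h0 : ∀ i, a i = 0 := by
        intro i
        by_cases hi : i < K
        · exact Finset.sum_eq_zero_iff.1 (by omega : ∑ i ∈ Finset.range K, a i = 0) i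
            (Finset.mem_range.2 hi)
        · exact ha i (not_lt.1 hi)
      have hS : ldPrefixes 0 a 0 = {[]} := by
        ext w
        constructor
        · intro hw
          have := length_of_mem_ldPrefixes ha hw
          exact List.length_eq_zero_iff.1 (by omega)
        · rintro rfl
          simp [ldPrefixes, h0]
      rw [hS]
      simp [h0]
    · exact htop 0 a ha hs
  | succ n ih =>
    intro a ha hs
    rcases hs.lt_or_eq with hs | hs
    · obtain ⟨hf, hc⟩ := ncard_ldPrefixes_step ih (Nat.zero_le K) a ha (by omega)
      refine ⟨hf, ?_⟩
      simp only [Finset.range_zero, Finset.prod_empty, Finset.sum_empty,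
        Nat.Ico_zero_eq_range] at hc
      have hn : ((n : ℤ) + 1) ≠ 0 := by positivity
      apply mul_left_cancel₀ hn
      push_cast
      linear_combination hc
    · exact htop (n + 1) a ha hs

theorem mem_ldPrefixes_iff_isLDWord {n k : ℕ} {a : ℕ → ℕ} (ha : ∀ i, k + 1 ≤ i → a i = 0)
    (hs : ∑ i ∈ Finset.range (k + 1), a i = n) (w : List (Option ℕ)) :
    w ∈ ldPrefixes n a 0 ↔
      IsLDWord n k w ∧ ∀ i : Fin (k + 1), w.count (some (i : ℕ)) = a i := by
  constructor
  · intro hw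
    have hlen := length_of_mem_ldPrefixes ha hw
    obtain ⟨h1, h2, h3, h4, -⟩ := hw
    refine ⟨⟨by omega, h1, ?_, h3, h4⟩, fun i => h2 i⟩
    rintro _ hx i rfl
    by_contra! hi
    have := List.count_pos_iff.2 hx
    rw [h2, ha i hi] at this
    omega
  · rintro ⟨⟨-, h1, h2, h3, h4⟩, h5⟩
    refine ⟨h1, fun i => ?_, h3, h4, fun _ _ => Nat.zero_le _⟩
    by_cases hi : i < k + 1
    · exact h5 ⟨i, hi⟩
    · rw [ha i (not_lt.1 hi), List.count_eq_zero]
      intro hx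
      have := h2 _ hx i rfl
      omega

theorem stmt5 (n k : ℕ) (hn : 1 ≤ n) (a : Fin (k + 1) → ℕ) (ha : ∑ i, a i = n) :
    (n + 1) * Nat.card { w : List (Option ℕ) // IsLDWord n k w ∧
        ∀ i : Fin (k + 1), w.count (some (i : ℕ)) = a i }
      = ∏ i : Fin (k + 1), Nat.choose (n + a i) (a i) := by
  let b : ℕ → ℕ := fun i => if h : i < k + 1 then a ⟨i, h⟩ else 0
  have hb : ∀ i : Fin (k + 1), b i = a i := fun i => dif_pos i.isLt
  have hb0 : ∀ i, k + 1 ≤ i → b i = 0 := fun i hi => dif_neg (by omega)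
  have hs : ∑ i ∈ Finset.range (k + 1), b i = n := by
    rw [Finset.sum_range, ← ha]
    exact Finset.sum_congr rfl fun i _ => hb i
  obtain ⟨-, hc⟩ := ncard_ldPrefixes (k + 1) n b hb0 (by omega)
  have hset : {w : List (Option ℕ) | IsLDWord n k w ∧
      ∀ i : Fin (k + 1), w.count (some (i : ℕ)) = a i} = ldPrefixes n b 0 := by
    ext w
    rw [mem_ldPrefixes_iff_isLDWord hb0 hs]
    simp [hb]
  change (n + 1) * Set.ncard {w : List (Option ℕ) | IsLDWord n k w ∧
      ∀ i : Fin (k + 1), w.count (some (i : ℕ)) = a i} = _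
  rw [hset]
  rw [← Nat.cast_sum, hs, add_sub_cancel_left, one_mul, Finset.prod_range] at hc
  simp only [hb] at hc
  exact_mod_cast hc
end

section
/- Let n ≥ 1 and k ≥ 0 be integers. Let EW_n(k) be the set of sequences w = w_1 w_2 … w_{2n+1} of letters from the alphabet {U, D_0, D_1, …, D_k} such that w_1 = U, exactly n+1 of the letters are U, and whenever two consecutive letters are w_j = D_a and w_{j+1} = D_b, one has a ≥ b. Then there exists a map p from EW_n(k) to the set of k-labeled Dyck words of length 2n such that (i) for every k-labeled Dyck word x of length 2n, the fiber p^{−1}(x) has exactly n+1 elements, and (ii) for every w in EW_n(k) and every 0 ≤ i ≤ k, the letter D_i occurs the same number of times in w as in p(w). -/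
/-- `w` is an extended `k`-labeled word of length `2n+1`: a word in the letters
`U` (= `none`) and `D_0,…,D_k` with first letter `U`, exactly `n+1` `U`'s, and
labels of consecutive down-steps weakly decreasing. -/
def IsEWWord (n k : ℕ) (w : List (Option ℕ)) : Prop :=
  w.length = 2 * n + 1 ∧ w.head? = some none ∧ w.count none = n + 1 ∧
  (∀ x ∈ w, ∀ i, x = some i → i ≤ k) ∧
  w.Chain' DownWeak

/-- Every nonempty prefix of `l` has strictly more `U`s than down-steps. -/
def PrefixPositive (l : List (Option ℕ)) : Prop :=
  ∀ p : List (Option ℕ), p <+: l → p ≠ [] → p.length < 2 * p.count none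

theorem prefixPositive_none_cons {x : List (Option ℕ)} :
    PrefixPositive (none :: x) ↔
      ∀ p : List (Option ℕ), p <+: x → p.length ≤ 2 * p.count none := by
  constructor
  · intro h p hp
    have := h (none :: p) (by simpa using hp) (by simp)
    simp at this
    omega
  · intro h p hp hne
    obtain ⟨a, q, rfl⟩ := List.exists_cons_of_ne_nil hne
    rw [List.cons_prefix_cons] at hp
    obtain ⟨rfl, hq⟩ := hp
    have := h q hq
    simp
    omega

theorem downWeak_none_left (y : Option ℕ) : DownWeak none y := by
  intro a b h
  simp at h

theorem downWeak_none_right (x : Option ℕ) : DownWeak x none := by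
  intro a b _ h
  simp at h

theorem isEWWord_none_cons {n k : ℕ} {x : List (Option ℕ)} :
    IsEWWord n k (none :: x) ∧ PrefixPositive (none :: x) ↔ IsLDWord n k x := by
  rw [prefixPositive_none_cons]
  constructor
  · rintro ⟨⟨h1, -, h3, h4, h5⟩, h6⟩
    refine ⟨by simpa using h1, by simpa using h3, fun y hy => h4 y (by simp [hy]), h6, ?_⟩
    exact List.IsChain.tail h5
  · rintro ⟨h1, h2, h3, h4, h5⟩
    refine ⟨⟨by simpa using h1, by simp, by simpa using h2, ?_, ?_⟩, h4⟩
    · intro y hy i hi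
      subst hi
      exact h3 _ (by simpa using hy) i rfl
    · exact List.isChain_cons.2 ⟨fun y _ => downWeak_none_left y, h5⟩

theorem IsEWWord.append_comm {n k : ℕ} {a b : List (Option ℕ)} (h : IsEWWord n k (a ++ b))
    (hb : (b ++ a).head? = some none) : IsEWWord n k (b ++ a) := by
  obtain ⟨h1, h2, h3, h4, h5⟩ := h
  refine ⟨by simp at h1 ⊢; omega, hb, by simp at h3 ⊢; omega, ?_, ?_⟩
  · intro y hy
    exact h4 y (by simp at hy ⊢; tauto)
  · obtain ⟨ha, hb', -⟩ := List.isChain_append.1 h5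
    refine List.isChain_append.2 ⟨hb', ha, fun u _ v hv => ?_⟩
    cases a with
    | nil => simp at hv
    | cons c a =>
      simp at h2 hv
      subst h2 hv
      exact downWeak_none_right u

theorem PrefixPositive.eq_nil_or_eq_nil {a b : List (Option ℕ)}
    (h₁ : PrefixPositive (a ++ b)) (h₂ : PrefixPositive (b ++ a))
    (h : 2 * (a ++ b).count none = (a ++ b).length + 1) : a = [] ∨ b = [] := by
  by_contra! hne
  have ha := h₁ a (List.prefix_append _ _) hne.1
  have hb := h₂ b (List.prefix_append _ _) hne.2
  simp at h
  omega

theorem List.IsRotated.eq_of_prefixPositive {l l' : List (Option ℕ)} (hr : l ~r l')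
    (h₁ : PrefixPositive l) (h₂ : PrefixPositive l')
    (h : 2 * l.count none = l.length + 1) : l = l' := by
  obtain ⟨m, hm, rfl⟩ := List.isRotated_iff_mod.1 hr
  rw [List.rotate_eq_drop_append_take hm] at h₂ ⊢
  rw [← List.take_append_drop m l] at h h₁
  rcases h₁.eq_nil_or_eq_nil h₂ h with h0 | h0 <;>
  · have := List.take_append_drop m l
    rw [h0] at this ⊢
    simpa using this.symm

theorem exists_prefixPositive_drop_append_take {l : List (Option ℕ)}
    (h : 2 * l.count none = l.length + 1) :
    ∃ m < l.length, PrefixPositive (l.drop m ++ l.take m) := by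
  have hpos : 0 < l.length := by
    rcases l with _ | ⟨a, l⟩
    · simp at h
    · simp
  set s : ℕ → ℤ := fun j => 2 * ((l.take j).count none : ℤ) - j with hs
  -- the last position at which the height is minimal
  obtain ⟨m, hm, hmin⟩ := Finset.exists_min_image (Finset.range l.length)
    (fun j => toLex (s j, -(j : ℤ))) ⟨0, by simpa using hpos⟩
  rw [Finset.mem_range] at hm
  have hle : ∀ j < l.length, s m ≤ s j := by
    intro j hj
    have := hmin j (by simpa using hj)
    rw [Prod.Lex.toLex_le_toLex] at this
    simp only at this
    omega
  have hlt : ∀ j < l.length, m < j → s m < s j := by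
    intro j hj hmj
    have := hmin j (by simpa using hj)
    rw [Prod.Lex.toLex_le_toLex] at this
    simp only at this
    omega
  have hzero : s m ≤ 0 := by simpa [hs] using hle 0 hpos
  have hsplit : ∀ i, (l.take (m + i)).count none =
      (l.take m).count none + ((l.drop m).take i).count none := by
    intro i
    rw [List.take_add, List.count_append]
  have htotal : l.count none = (l.take m).count none + (l.drop m).count none := by
    rw [← List.count_append, List.take_append_drop]
  refine ⟨m, hm, fun p hp hne => ?_⟩
  have hlen : 0 < p.length := List.length_pos_iff.2 hne
  have hple := hp.length_le
  rw [List.prefix_iff_eq_take] at hp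
  rw [List.length_append, List.length_drop, List.length_take] at hple
  rw [List.take_append, List.length_drop] at hp
  have hc := congrArg (List.count none) hp
  rw [List.count_append] at hc
  rcases lt_trichotomy (m + p.length) l.length with hj | hj | hj
  · have h1 := hlt _ hj (by omega)
    have h2 := hsplit p.length
    simp only [hs] at h1
    push_cast at h1
    omega
  · rw [List.take_of_length_le (l := l.drop m) (by simp; omega)] at hc
    simp only [hs] at hzero
    omega
  · rw [List.take_of_length_le (l := l.drop m) (by simp; omega), List.take_take,
      min_eq_left (by omega)] at hc
    have h1 := hle (p.length - (l.length - m)) (by omega)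
    simp only [hs] at h1
    omega

theorem IsEWWord.two_mul_count {n k : ℕ} {w : List (Option ℕ)} (h : IsEWWord n k w) :
    2 * w.count none = w.length + 1 := by
  rw [h.1, h.2.2.1]
  ring

theorem IsEWWord.exists_isRotated {n k : ℕ} {w : List (Option ℕ)} (h : IsEWWord n k w) :
    ∃ x, IsLDWord n k x ∧ w ~r none :: x := by
  obtain ⟨m, hm, hpp⟩ := exists_prefixPositive_drop_append_take h.two_mul_count
  have hrot : w ~r w.drop m ++ w.take m :=
    ⟨m, List.rotate_eq_drop_append_take hm.le⟩
  rw [← List.take_append_drop m w] at h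
  have hew := h.append_comm
  revert hpp hrot hew
  generalize hv : w.drop m ++ w.take m = v
  intro hpp hrot hew
  rcases v with _ | ⟨a, x⟩
  · have := congrArg List.length hv
    simp at this
    omega
  · have ha := hpp [a] (by simp) (by simp)
    obtain rfl : a = none := by
      by_contra hne
      simp [hne] at ha
    exact ⟨x, isEWWord_none_cons.1 ⟨hew rfl, hpp⟩, hrot⟩

theorem List.card_subtype_get_eq {α : Type*} [BEq α] [LawfulBEq α] (l : List α) (a : α) :
    Nat.card { i : Fin l.length // l.get i = a } = l.count a := by
  classical
  rw [Nat.card_eq_fintype_card, Fintype.card_subtype]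
  refine (Fin.card_filter_univ_eq_vector_get_eq_count a ⟨l, rfl⟩).trans ?_
  exact List.countP_congr fun x _ => by simp

theorem IsLDWord.card_isRotated {n k : ℕ} {x : List (Option ℕ)} (hx : IsLDWord n k x) :
    Nat.card { w : { w // IsEWWord n k w } // w.val ~r none :: x } = n + 1 := by
  obtain ⟨hew, hpp⟩ := isEWWord_none_cons.2 hx
  generalize none :: x = l at hew hpp
  have hrot (i : Fin l.length) (hi : l.get i = none) : IsEWWord n k (l.rotate i) := by
    rw [List.rotate_eq_drop_append_take i.2.le]
    refine IsEWWord.append_comm (by rwa [List.take_append_drop]) ?_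
    rw [List.drop_eq_getElem_cons i.2]
    simpa using hi
  rw [← hew.2.2.1, ← List.card_subtype_get_eq]
  refine (Nat.card_congr (Equiv.ofBijective
    (fun i => ⟨⟨l.rotate i.1, hrot i.1 i.2⟩, List.IsRotated.symm ⟨_, rfl⟩⟩) ⟨?_, ?_⟩)).symm
  · have key : ∀ i j : ℕ, i < j → j < l.length → l.rotate i ≠ l.rotate j := by
      intro i j hij hj h
      have h' : l = l.rotate (j - i) := by
        apply List.rotate_injective i
        simp only [List.rotate_rotate]
        rwa [Nat.sub_add_cancel hij.le]
      have hb := hpp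
      rw [h', List.rotate_eq_drop_append_take (by omega)] at hb
      have ha := hpp
      have hc := hew.two_mul_count
      rw [← List.take_append_drop (j - i) l] at ha hc
      rcases ha.eq_nil_or_eq_nil hb hc with h0 | h0 <;>
      · have := congrArg List.length h0
        simp at this
        grind
    intro i j h
    have h : l.rotate i.1 = l.rotate j.1 := by simpa using h
    rcases lt_trichotomy i.1.1 j.1.1 with hij | hij | hij
    · exact absurd h (key _ _ hij j.1.2)
    · exact Subtype.ext (Fin.ext hij)
    · exact absurd h.symm (key _ _ hij i.1.2)
  · rintro ⟨⟨w, hw⟩, hr⟩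
    obtain ⟨m, hm, hmw⟩ := List.isRotated_iff_mod.1 hr.symm
    have hpos : 0 < l.length := by
      have := hew.1
      omega
    have hlt : m % l.length < l.length := Nat.mod_lt _ hpos
    rw [← List.rotate_mod] at hmw
    refine ⟨⟨⟨m % l.length, hlt⟩, ?_⟩, ?_⟩
    · have h2 := hw.2.1
      change _ = w at hmw
      rw [← hmw, List.head?_rotate hlt] at h2
      simpa [List.getElem?_eq_getElem hlt] using h2
    · simpa using hmw

theorem stmt6 (n k : ℕ) (hn : 1 ≤ n) :
    ∃ p : { w : List (Option ℕ) // IsEWWord n k w } →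
          { w : List (Option ℕ) // IsLDWord n k w },
      (∀ x, Nat.card { w : { w : List (Option ℕ) // IsEWWord n k w } // p w = x } = n + 1) ∧
      (∀ w : { w : List (Option ℕ) // IsEWWord n k w }, ∀ i ≤ k,
        (p w).val.count (some i) = w.val.count (some i)) := by
  choose f hf hrot using fun w : { w // IsEWWord n k w } => w.2.exists_isRotated
  refine ⟨fun w => ⟨f w, hf w⟩, fun x => ?_, fun w i _ => ?_⟩
  · rw [← x.2.card_isRotated]
    refine Nat.card_congr (Equiv.subtypeEquivRight fun w => ⟨?_, fun h => Subtype.ext ?_⟩)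
    · rintro rfl
      exact hrot w
    · obtain ⟨hew, hpp⟩ := isEWWord_none_cons.2 (hf w)
      have := ((hrot w).symm.trans h).eq_of_prefixPositive hpp
        (isEWWord_none_cons.2 x.2).2 hew.two_mul_count
      simpa using this
  · rw [(hrot w).perm.count_eq]
    simp
end

section
/- For all integers n ≥ 2 and k ≥ 1, (k(n+1) + n − 2) · |DLD_{n−1}(k)| = binom(kn + k + 2n − 3, n) · binom(n + k − 2, k − 1). -/
/-- `w` is a doubly `k`-labeled Dyck word of length `2n`: each entry is a pair
whose first component is a letter of a `k`-labeled Dyck word, and whose second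
component is an additional label in `{1,…,k}` exactly when the letter is `U` or
`D_0` (and `none` otherwise); the sequence of additional labels, read from left
to right, is weakly increasing. -/
def IsDLDWord (n k : ℕ) (w : List (Option ℕ × Option ℕ)) : Prop :=
  IsLDWord n k (w.map Prod.fst) ∧
  (∀ x ∈ w,
    ((x.1 = none ∨ x.1 = some 0) → ∃ l, x.2 = some l ∧ 1 ≤ l ∧ l ≤ k) ∧
    (¬ (x.1 = none ∨ x.1 = some 0) → x.2 = none)) ∧
  List.Chain' (· ≤ ·) (w.filterMap Prod.snd)

namespace Nat

theorem mul_multichoose_succ (n j : ℕ) :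
    n * multichoose (n + 1) j = (n + j) * multichoose n j := by
  rcases n with _ | n
  · rcases j with _ | j <;> simp
  · have h := choose_mul_succ_eq (n + j) j
    rw [multichoose_eq, multichoose_eq, show n + 1 + 1 + j - 1 = n + j + 1 by omega,
      show n + 1 + j - 1 = n + j by omega]
    rw [show n + j + 1 - j = n + 1 by omega] at h
    rw [mul_comm, ← h, mul_comm]
    ring

/-- Vandermonde's identity for multiset coefficients. -/
theorem sum_range_multichoose_mul (x y m : ℕ) :
    ∑ a ∈ Finset.range (m + 1), multichoose x a * multichoose y (m - a) =
      multichoose (x + y) m := by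
  induction x generalizing m with
  | zero => simp [Finset.sum_range_succ']
  | succ x ih =>
    induction m with
    | zero => simp
    | succ m ihm =>
      rw [show x + 1 + y = x + y + 1 by ring, multichoose_succ_succ, ← ih,
        show x + y + 1 = x + 1 + y by ring, ← ihm, Finset.sum_range_succ',
        Finset.sum_range_succ' _ (m + 1)]
      simp only [multichoose_succ_succ, add_mul, Finset.sum_add_distrib, Nat.add_sub_add_right,
        multichoose_zero_right]
      ring

theorem multichoose_succ_mul_multichoose (m a k : ℕ) :
    multichoose (m + 1) a * multichoose k (m + a) = multichoose k m * multichoose (k + m) a := by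
  rcases k with _ | k
  · rcases m with _ | m
    · rcases a with _ | a <;> simp
    · simp [show m + 1 + a = m + a + 1 by ring]
  · simp only [multichoose_eq]
    rw [show m + 1 + a - 1 = m + a by omega, show k + 1 + (m + a) - 1 = k + m + a by omega,
      show k + 1 + m - 1 = k + m by omega, show k + 1 + m + a - 1 = k + m + a by omega]
    have h := choose_mul (n := k + m + a) (k := m + a) (s := a) (by omega)
    rw [show k + m + a - a = k + m by omega, show m + a - a = m by omega] at h
    rw [mul_comm, h, mul_comm]

end Nat

/-- The number of prefixes of `k`-labeled Dyck words with `a` letters `D_0` and `b` other down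
letters, in which the last letter is `U` or `D_i` with `i` in a set of `s` nonzero labels,
when there are `m` letters `U` and `t = s + k * m`. -/
def prefixCount (k m t a b : ℕ) : ℤ :=
  (2 * m.multichoose a - (m + 1).multichoose a) * t.multichoose b -
    k * m.multichoose a * ((t + 1).multichoose b - t.multichoose b)

theorem prefixCount_succ_right (k m t a b : ℕ) : prefixCount k m (t + 1) a (b + 1) =
    prefixCount k m t a (b + 1) + prefixCount k m (t + 1) a b := by
  simp only [prefixCount, Nat.multichoose_succ_succ]
  push_cast
  ring

theorem prefixCount_succ_left (k m t a b : ℕ) : prefixCount k (m + 1) t (a + 1) b =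
    prefixCount k m t (a + 1) b + prefixCount k (m + 1) t a b := by
  simp only [prefixCount, Nat.multichoose_succ_succ]
  push_cast
  ring

theorem prefixCount_zero_right (k m t t' a : ℕ) :
    prefixCount k m t a 0 = prefixCount k m t' a 0 := by
  simp [prefixCount]

theorem prefixCount_zero_left (k m m' t b : ℕ) :
    prefixCount k m t 0 b = prefixCount k m' t 0 b := by
  simp [prefixCount]

theorem mul_prefixCount (k m a b : ℕ) : m * prefixCount k m (k * m) a b =
    (m - a - b) * (m.multichoose a * (k * m).multichoose b) := by
  have h1 : (m : ℤ) * (m + 1).multichoose a = (m + a) * m.multichoose a :=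
    mod_cast Nat.mul_multichoose_succ m a
  have h2 : ((k * m : ℕ) : ℤ) * (k * m + 1).multichoose b =
      ((k * m : ℕ) + b) * (k * m).multichoose b :=
    mod_cast Nat.mul_multichoose_succ (k * m) b
  push_cast at h2
  simp only [prefixCount]
  linear_combination (-((k * m).multichoose b : ℤ)) * h1 - (m.multichoose a : ℤ) * h2

/-- Prefixes of doubly labeled Dyck words with `m` letters `U`, `a` letters `D_0` and `b` other
letters, whose additional labels are at most `l` and whose last letter is not a `D_i`
with `i < c`. -/
structure LabeledPrefix (k m a b c l : ℕ) (w : List (Option ℕ × Option ℕ)) : Prop where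
  count_up : (w.map Prod.fst).count none = m
  count_zero : (w.map Prod.fst).count (some 0) = a
  length_eq : w.length = m + a + b
  down_le : ∀ x ∈ w, ∀ i, x.1 = some i → i ≤ k
  ballot : ∀ p : List (Option ℕ), p <+: w.map Prod.fst → p.length ≤ 2 * p.count none
  chain : (w.map Prod.fst).IsChain DownWeak
  labeled : ∀ x ∈ w, ((x.1 = none ∨ x.1 = some 0) → ∃ j, x.2 = some j ∧ 1 ≤ j) ∧
    (¬ (x.1 = none ∨ x.1 = some 0) → x.2 = none)
  sorted : (w.filterMap Prod.snd).Pairwise (· ≤ ·)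
  label_le : ∀ j ∈ w.filterMap Prod.snd, j ≤ l
  le_last : ∀ i, (w.map Prod.fst).getLast? = some (some i) → c ≤ i

namespace LabeledPrefix

variable {k m a b c l : ℕ} {v w : List (Option ℕ × Option ℕ)}

theorem down_add_le (h : LabeledPrefix k m a b c l w) : a + b ≤ m := by
  have h1 := h.ballot _ List.prefix_rfl
  have h2 := h.length_eq
  have h3 := h.count_up
  simp only [List.length_map] at h1
  omega

theorem nil_iff : LabeledPrefix k m a b c l [] ↔ m = 0 ∧ a = 0 ∧ b = 0 := by
  constructor
  · rintro h
    have h1 := h.count_up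
    have h2 := h.count_zero
    have h3 := h.length_eq
    simp at h1 h2 h3
    omega
  · rintro ⟨rfl, rfl, rfl⟩
    constructor <;> simp

theorem concat_up_iff {j : ℕ} : LabeledPrefix k (m + 1) a b c l (v ++ [(none, some j)]) ↔
    (1 ≤ j ∧ j ≤ l) ∧ LabeledPrefix k m a b 0 j v := by
  constructor
  · rintro ⟨h1, h2, h3, h4, h5, h6, h7, h8, h9, h10⟩
    simp [List.pairwise_append, List.isChain_append, or_imp, forall_and, List.prefix_concat_iff]
      at h1 h2 h3 h4 h5 h6 h7 h8 h9
    refine ⟨⟨h7.1.1.2, h9.2⟩, h1, h2, by omega, by simpa using h4, h5.2, h6.1, ?_, h8.1,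
      by simpa using h8.2, by simp⟩
    simpa [or_imp, forall_and] using ⟨⟨h7.1.1.1, h7.1.2⟩, h7.2⟩
  · rintro ⟨⟨hj, hl⟩, h⟩
    have := h.down_add_le
    obtain ⟨h1, h2, h3, h4, h5, h6, h7, h8, h9, h10⟩ := h
    constructor <;> simp [List.pairwise_append, List.isChain_append, or_imp, forall_and,
      List.prefix_concat_iff, DownWeak] at *
    all_goals grind

theorem concat_zero_iff {j : ℕ} : LabeledPrefix k m (a + 1) b c l (v ++ [(some 0, some j)]) ↔
    c = 0 ∧ a + 1 + b ≤ m ∧ (1 ≤ j ∧ j ≤ l) ∧ LabeledPrefix k m a b 0 j v := by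
  constructor
  · intro h
    have := h.down_add_le
    rcases h with ⟨h1, h2, h3, h4, h5, h6, h7, h8, h9, h10⟩
    simp [List.pairwise_append, List.isChain_append, or_imp, forall_and, List.prefix_concat_iff]
      at h1 h2 h3 h4 h5 h6 h7 h8 h9 h10
    refine ⟨h10, this, ⟨h7.1.2.2, h9.2⟩, h1, h2, by omega, by simpa using h4, h5.2, h6.1, ?_, h8.1,
      by simpa using h8.2, by simp⟩
    simpa [or_imp, forall_and] using ⟨⟨h7.1.1, h7.1.2.1⟩, h7.2⟩
  · rintro ⟨rfl, h0, ⟨hj, hl⟩, ⟨h1, h2, h3, h4, h5, h6, h7, h8, h9, h10⟩⟩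
    constructor <;> simp [List.pairwise_append, List.isChain_append, or_imp, forall_and,
      List.prefix_concat_iff, DownWeak] at *
    all_goals grind

theorem concat_succ_iff {i : ℕ} : LabeledPrefix k m a (b + 1) c l (v ++ [(some (i + 1), none)]) ↔
    (c ≤ i + 1 ∧ i + 1 ≤ k) ∧ a + b + 1 ≤ m ∧ LabeledPrefix k m a b (i + 1) l v := by
  constructor
  · intro h
    have := h.down_add_le
    rcases h with ⟨h1, h2, h3, h4, h5, h6, h7, h8, h9, h10⟩
    simp [List.isChain_append, or_imp, forall_and, List.prefix_concat_iff]
      at h1 h2 h3 h4 h5 h6 h7 h8 h9 h10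
    refine ⟨⟨h10, h4.2⟩, this, h1, h2, by omega, by simpa using h4.1, h5.2, h6.1, ?_, h8,
      by simpa using h9, ?_⟩
    · simpa [or_imp, forall_and] using h7
    · intro i' hi'
      simp only [List.getLast?_map, Option.map_eq_some_iff, Prod.exists] at hi'
      obtain ⟨_, z, hz, rfl⟩ := hi'
      exact h6.2 _ z hz _ _ rfl rfl
  · rintro ⟨⟨hc, hk⟩, h0, ⟨h1, h2, h3, h4, h5, h6, h7, h8, h9, h10⟩⟩
    constructor <;> simp [List.isChain_append, or_imp, forall_and,
      List.prefix_concat_iff, DownWeak] at *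
    all_goals grind

/-- The last letter of a nonempty prefix is one of the three kinds of letters. -/
theorem last_cases {x : Option ℕ × Option ℕ} (h : LabeledPrefix k m a b c l (v ++ [x])) :
    (∃ j m', m = m' + 1 ∧ x = (none, some j)) ∨ (∃ j a', a = a' + 1 ∧ x = (some 0, some j)) ∨
      ∃ i b', b = b' + 1 ∧ x = (some (i + 1), none) := by
  have hx := h.labeled x (by simp)
  have h1 := h.count_up
  have h2 := h.count_zero
  have h3 := h.length_eq
  obtain ⟨y, z⟩ := x
  match y with
  | none =>
    obtain ⟨j, rfl, -⟩ := hx.1 (by simp)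
    simp at h1
    exact Or.inl ⟨j, _, h1.symm, rfl⟩
  | some 0 =>
    obtain ⟨j, rfl, -⟩ := hx.1 (by simp)
    simp at h2
    exact Or.inr (Or.inl ⟨j, _, h2.symm, rfl⟩)
  | some (i + 1) =>
    obtain rfl := hx.2 (by simp)
    refine Or.inr (Or.inr ⟨i, b - 1, ?_, rfl⟩)
    have : ∀ u : List (Option ℕ), u.count none + u.count (some 0) ≤ u.length := by
      intro u
      induction u with
      | nil => simp
      | cons y u ih => rcases y with _ | _ | y <;> simp <;> omega
    have := this (v.map Prod.fst)
    simp at h1 h2 h3 this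
    omega

theorem mono {c' : ℕ} (hc : c' ≤ c) (h : LabeledPrefix k m a b c l w) :
    LabeledPrefix k m a b c' l w :=
  { h with le_last := fun i hi => hc.trans (h.le_last i hi) }

theorem setOf_down_succ {i : ℕ} (hi : i + 1 ≤ k) (hm : a + b + 1 ≤ m) :
    {w | LabeledPrefix k m a (b + 1) (i + 1) l w} =
      {w | LabeledPrefix k m a (b + 1) (i + 2) l w} ∪
        (· ++ [(some (i + 1), none)]) '' {w | LabeledPrefix k m a b (i + 1) l w} := by
  ext w
  simp only [Set.mem_ofPred_eq, Set.mem_union, Set.mem_image]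
  constructor
  · intro h
    rcases w.eq_nil_or_concat' with rfl | ⟨v, x, rfl⟩
    · exact Or.inl (nil_iff.2 (nil_iff.1 h))
    rcases h.last_cases with ⟨j, m, rfl, rfl⟩ | ⟨j, a, rfl, rfl⟩ | ⟨i', b', hb, rfl⟩
    · exact Or.inl (concat_up_iff.2 (concat_up_iff.1 h))
    · exact absurd (concat_zero_iff.1 h).1 (by simp)
    · obtain ⟨⟨h1, h2⟩, h3, h4⟩ := concat_succ_iff.1 h
      rcases h1.eq_or_lt with h1 | h1
      · obtain rfl : i = i' := by omega
        exact Or.inr ⟨v, h4, rfl⟩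
      · exact Or.inl (concat_succ_iff.2 ⟨⟨h1, h2⟩, h3, h4⟩)
  · rintro (h | ⟨v, h, rfl⟩)
    · exact h.mono (by omega)
    · exact concat_succ_iff.2 ⟨⟨le_rfl, hi⟩, hm, h⟩

theorem setOf_zero_succ (hm : a + 1 + b ≤ m) :
    {w | LabeledPrefix k m (a + 1) b 0 l w} =
      {w | LabeledPrefix k m (a + 1) b 1 l w} ∪
        {w | ∃ j v, (1 ≤ j ∧ j ≤ l) ∧ v ∈ {v | LabeledPrefix k m a b 0 j v} ∧
          w = v ++ [(some 0, some j)]} := by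
  ext w
  simp only [Set.mem_ofPred_eq, Set.mem_union]
  constructor
  · intro h
    rcases w.eq_nil_or_concat' with rfl | ⟨v, x, rfl⟩
    · exact Or.inl (nil_iff.2 (nil_iff.1 h))
    rcases h.last_cases with ⟨j, m, rfl, rfl⟩ | ⟨j, a, h0, rfl⟩ | ⟨i', b, rfl, rfl⟩
    · exact Or.inl (concat_up_iff.2 (concat_up_iff.1 h))
    · obtain ⟨-, -, h3, h4⟩ := concat_zero_iff.1 h
      exact Or.inr ⟨j, v, h3, h4, rfl⟩
    · obtain ⟨⟨h1, h2⟩, h3, h4⟩ := concat_succ_iff.1 h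
      exact Or.inl (concat_succ_iff.2 ⟨⟨by omega, h2⟩, h3, h4⟩)
  · rintro (h | ⟨j, v, hj, h, rfl⟩)
    · exact h.mono (by omega)
    · exact concat_zero_iff.2 ⟨rfl, hm, hj, h⟩

theorem setOf_up_succ :
    {w | LabeledPrefix k (m + 1) a b (k + 1) l w} =
      {w | ∃ j v, (1 ≤ j ∧ j ≤ l) ∧ v ∈ {v | LabeledPrefix k m a b 0 j v} ∧
        w = v ++ [(none, some j)]} := by
  ext w
  simp only [Set.mem_ofPred_eq]
  constructor
  · intro h
    rcases w.eq_nil_or_concat' with rfl | ⟨v, x, rfl⟩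
    · simp [nil_iff] at h
    rcases h.last_cases with ⟨j, m, h0, rfl⟩ | ⟨j, a, rfl, rfl⟩ | ⟨i', b, rfl, rfl⟩
    · obtain ⟨h3, h4⟩ := concat_up_iff.1 h
      exact ⟨j, v, h3, h4, rfl⟩
    · exact absurd (concat_zero_iff.1 h).1 (by simp)
    · have := (concat_succ_iff.1 h).1
      omega
  · rintro ⟨j, v, hj, h, rfl⟩
    exact concat_up_iff.2 ⟨hj, h⟩

theorem down_zero_iff {i : ℕ} : LabeledPrefix k m a 0 (i + 2) l w ↔
    LabeledPrefix k m a 0 (i + 1) l w := by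
  refine ⟨mono (by omega), fun h => ?_⟩
  rcases w.eq_nil_or_concat' with rfl | ⟨v, x, rfl⟩
  · exact nil_iff.2 (nil_iff.1 h)
  rcases h.last_cases with ⟨j, m, rfl, rfl⟩ | ⟨j, a, rfl, rfl⟩ | ⟨i', b, hb, rfl⟩
  · exact concat_up_iff.2 (concat_up_iff.1 h)
  · exact absurd (concat_zero_iff.1 h).1 (by simp)
  · omega

theorem zero_zero_iff : LabeledPrefix k m 0 b 1 l w ↔ LabeledPrefix k m 0 b 0 l w := by
  refine ⟨mono (by omega), fun h => ?_⟩
  rcases w.eq_nil_or_concat' with rfl | ⟨v, x, rfl⟩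
  · exact nil_iff.2 (nil_iff.1 h)
  rcases h.last_cases with ⟨j, m, rfl, rfl⟩ | ⟨j, a, h0, rfl⟩ | ⟨i', b, rfl, rfl⟩
  · exact concat_up_iff.2 (concat_up_iff.1 h)
  · omega
  · obtain ⟨⟨h1, h2⟩, h3, h4⟩ := concat_succ_iff.1 h
    exact concat_succ_iff.2 ⟨⟨by omega, h2⟩, h3, h4⟩

end LabeledPrefix

theorem encard_concat_label {α : Type*} (x : α) {T : ℕ → Set (List (α × Option ℕ))} {q r : ℕ}
    (hT : ∀ l, (T l).encard = (q * l.multichoose r : ℕ)) (l : ℕ) :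
    {w | ∃ j v, (1 ≤ j ∧ j ≤ l) ∧ v ∈ T j ∧ w = v ++ [(x, some j)]}.encard =
      (q * l.multichoose (r + 1) : ℕ) := by
  induction l with
  | zero =>
    have : {w | ∃ j v, (1 ≤ j ∧ j ≤ 0) ∧ v ∈ T j ∧ w = v ++ [(x, some j)]} = ∅ := by
      ext w
      simp only [Set.mem_ofPred_eq, Set.mem_empty_iff_false, iff_false]
      rintro ⟨j, v, hj, -⟩
      omega
    rw [this]
    simp
  | succ l ih =>
    have : {w | ∃ j v, (1 ≤ j ∧ j ≤ l + 1) ∧ v ∈ T j ∧ w = v ++ [(x, some j)]} =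
        {w | ∃ j v, (1 ≤ j ∧ j ≤ l) ∧ v ∈ T j ∧ w = v ++ [(x, some j)]} ∪
          (· ++ [(x, some (l + 1))]) '' T (l + 1) := by
      ext w
      simp only [Set.mem_ofPred_eq, Set.mem_union, Set.mem_image]
      constructor
      · rintro ⟨j, v, ⟨h1, h2⟩, hv, rfl⟩
        rcases h2.eq_or_lt with rfl | h2
        · exact Or.inr ⟨v, hv, rfl⟩
        · exact Or.inl ⟨j, v, ⟨h1, by omega⟩, hv, rfl⟩
      · rintro (⟨j, v, ⟨h1, h2⟩, hv, rfl⟩ | ⟨v, hv, rfl⟩)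
        · exact ⟨j, v, ⟨h1, by omega⟩, hv, rfl⟩
        · exact ⟨l + 1, v, ⟨by omega, le_rfl⟩, hv, rfl⟩
    rw [this, Set.encard_union_eq, ih, (List.append_left_injective _).encard_image, hT,
      Nat.multichoose_succ_succ]
    · push_cast
      ring
    · rw [Set.disjoint_left]
      rintro _ ⟨j, v, ⟨h1, h2⟩, hv, rfl⟩ ⟨u, hu, huv⟩
      simp at huv
      omega

/-- There are `q` sequences of letters underlying the prefixes described by `LabeledPrefix`, each
of which has as many labelings as there are multisets of labels. -/
def HasPrefixCount (k m a b c q : ℕ) : Prop :=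
  ∀ l, {w | LabeledPrefix k m a b c l w}.encard = (q * l.multichoose (m + a) : ℕ)

namespace HasPrefixCount

variable {k m a b q q₁ q₂ : ℕ}

theorem down_succ {i : ℕ} (hi : i + 1 ≤ k) (hm : a + b + 1 ≤ m)
    (h₁ : HasPrefixCount k m a (b + 1) (i + 2) q₁) (h₂ : HasPrefixCount k m a b (i + 1) q₂) :
    HasPrefixCount k m a (b + 1) (i + 1) (q₁ + q₂) := by
  intro l
  rw [LabeledPrefix.setOf_down_succ hi hm, Set.encard_union_eq, h₁,
    (List.append_left_injective _).encard_image, h₂]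
  · push_cast
    ring
  · rw [Set.disjoint_left]
    rintro _ h ⟨v, hv, rfl⟩
    have := (LabeledPrefix.concat_succ_iff.1 h).1
    omega

theorem down_zero {i : ℕ} (h : HasPrefixCount k m a 0 (i + 2) q) :
    HasPrefixCount k m a 0 (i + 1) q := by
  simpa only [HasPrefixCount, LabeledPrefix.down_zero_iff] using h

theorem zero_succ (hm : a + 1 + b ≤ m)
    (h₁ : HasPrefixCount k m (a + 1) b 1 q₁) (h₂ : HasPrefixCount k m a b 0 q₂) :
    HasPrefixCount k m (a + 1) b 0 (q₁ + q₂) := by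
  intro l
  rw [LabeledPrefix.setOf_zero_succ hm, Set.encard_union_eq, h₁,
    encard_concat_label (some 0) h₂]
  · rw [← Nat.cast_add, add_mul]
    rfl
  · rw [Set.disjoint_left]
    rintro _ h ⟨j, v, hj, hv, rfl⟩
    have := (LabeledPrefix.concat_zero_iff.1 h).1
    omega

theorem zero_zero (h : HasPrefixCount k m 0 b 1 q) : HasPrefixCount k m 0 b 0 q := by
  simpa only [HasPrefixCount, LabeledPrefix.zero_zero_iff] using h

theorem up_succ (h : HasPrefixCount k m a b 0 q) : HasPrefixCount k (m + 1) a b (k + 1) q := by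
  intro l
  rw [LabeledPrefix.setOf_up_succ, encard_concat_label none h, show m + a + 1 = m + 1 + a by ring]

theorem of_lt (h : m < a + b) : HasPrefixCount k m a b 0 0 := by
  intro l
  have : {w | LabeledPrefix k m a b 0 l w} = ∅ := by
    ext w
    simp only [Set.mem_ofPred_eq, Set.mem_empty_iff_false, iff_false]
    intro hw
    have := hw.down_add_le
    omega
  simp [this]

theorem nil : HasPrefixCount k 0 0 0 (k + 1) 1 := by
  intro l
  have : {w | LabeledPrefix k 0 0 0 (k + 1) l w} = {[]} := by
    ext w
    simp only [Set.mem_ofPred_eq, Set.mem_singleton_iff]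
    refine ⟨fun hw => List.eq_nil_of_length_eq_zero hw.length_eq, ?_⟩
    rintro rfl
    exact LabeledPrefix.nil_iff.2 (by simp)
  simp [this]

theorem exists_of_up {t : ℕ}
    (h : ∀ a b, a + b ≤ m → ∃ q : ℕ, (q : ℤ) = prefixCount k m t a b ∧
      HasPrefixCount k m a b (k + 1) q) (s : ℕ) (hs : s ≤ k) (a b : ℕ) (hab : a + b ≤ m) :
    ∃ q : ℕ, (q : ℤ) = prefixCount k m (t + s) a b ∧ HasPrefixCount k m a b (k - s + 1) q := by
  induction s generalizing b with
  | zero => exact h a b hab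
  | succ s ih =>
    have hks : k - s + 1 = k - (s + 1) + 2 := by omega
    induction b with
    | zero =>
      obtain ⟨q, hq, H⟩ := ih (by omega) 0 hab
      refine ⟨q, hq.trans (prefixCount_zero_right ..), down_zero ?_⟩
      rwa [hks] at H
    | succ b ihb =>
      obtain ⟨q₁, hq₁, H₁⟩ := ih (by omega) (b + 1) hab
      obtain ⟨q₂, hq₂, H₂⟩ := ihb (by omega)
      rw [hks] at H₁
      refine ⟨q₁ + q₂, ?_, down_succ (by omega) (by omega) H₁ H₂⟩
      push_cast
      rw [hq₁, hq₂, ← add_assoc, prefixCount_succ_right]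

theorem exists_of_down {t : ℕ}
    (h : ∀ a b, a + b ≤ m → ∃ q : ℕ, (q : ℤ) = prefixCount k m t a b ∧
      HasPrefixCount k m a b 1 q) (a b : ℕ) (hab : a + b ≤ m) :
    ∃ q : ℕ, (q : ℤ) = prefixCount k (m + 1) t a b ∧ HasPrefixCount k m a b 0 q := by
  induction a with
  | zero =>
    obtain ⟨q, hq, H⟩ := h 0 b hab
    exact ⟨q, hq.trans (prefixCount_zero_left ..), zero_zero H⟩
  | succ a iha =>
    obtain ⟨q₁, hq₁, H₁⟩ := h (a + 1) b hab
    obtain ⟨q₂, hq₂, H₂⟩ := iha (by omega)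
    refine ⟨q₁ + q₂, ?_, zero_succ hab H₁ H₂⟩
    push_cast
    rw [hq₁, hq₂, prefixCount_succ_left]

theorem exists_all (k m a b : ℕ) (hab : a + b ≤ m) :
    ∃ q : ℕ, (q : ℤ) = prefixCount k (m + 1) (k * (m + 1)) a b ∧ HasPrefixCount k m a b 0 q := by
  induction m generalizing a b with
  | zero =>
    refine exists_of_down (fun a b hab => ?_) a b hab
    have := exists_of_up (k := k) (m := 0) (t := k * 0) (fun a b hab => ?_) k le_rfl a b hab
    · simpa using this
    · obtain ⟨rfl, rfl⟩ : a = 0 ∧ b = 0 := by omega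
      exact ⟨1, by simp [prefixCount], nil⟩
  | succ m ih =>
    refine exists_of_down (fun a b hab => ?_) a b hab
    have := exists_of_up (k := k) (m := m + 1) (t := k * (m + 1)) (fun a b hab => ?_) k le_rfl a b
      hab
    · simpa [mul_add] using this
    · rcases hab.eq_or_lt with hab | hab
      · refine ⟨0, ?_, up_succ (of_lt (by omega))⟩
        have h := mul_prefixCount k (m + 1) a b
        rw [← hab] at h
        have h0 : ((a + b : ℕ) : ℤ) ≠ 0 := by
          rw [hab]
          positivity
        push_cast at h h0 ⊢
        rw [show (a + b - a - b : ℤ) = 0 by ring, zero_mul] at h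
        rw [← hab]
        exact ((mul_eq_zero.1 h).resolve_left h0).symm
      · obtain ⟨q, hq, H⟩ := ih a b (by omega)
        exact ⟨q, hq, up_succ H⟩

end HasPrefixCount

theorem encard_setOf_exists_lt {α : Type*} (S : ℕ → Set α) (f : ℕ → ℕ) (N : ℕ)
    (hS : ∀ a < N, (S a).encard = (f a : ℕ)) (hd : Pairwise (Function.onFun Disjoint S)) :
    {w | ∃ a < N, w ∈ S a}.encard = (∑ a ∈ Finset.range N, f a : ℕ) := by
  induction N with
  | zero => simp
  | succ N ih =>
    have : {w | ∃ a < N + 1, w ∈ S a} = {w | ∃ a < N, w ∈ S a} ∪ S N := by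
      ext w
      simp only [Set.mem_union, Set.mem_ofPred_eq, Nat.lt_succ_iff_lt_or_eq, or_and_right, exists_or,
        exists_eq_left]
    rw [this, Set.encard_union_eq, ih fun a ha => hS a (by omega), hS N (by omega),
      Finset.sum_range_succ]
    · push_cast
      rfl
    · rw [Set.disjoint_left]
      rintro w ⟨a, ha, hw⟩
      exact Set.disjoint_left.1 (hd ha.ne) hw

theorem isDLDWord_iff {m k : ℕ} {w : List (Option ℕ × Option ℕ)} :
    IsDLDWord m k w ↔ ∃ a < m + 1, LabeledPrefix k m a (m - a) 0 k w := by
  constructor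
  · rintro ⟨⟨h1, h2, h3, h4, h5⟩, h6, h7⟩
    have hle : ∀ u : List (Option ℕ), u.count none + u.count (some 0) ≤ u.length := by
      intro u
      induction u with
      | nil => simp
      | cons y u ih => rcases y with _ | _ | y <;> simp <;> omega
    have := hle (w.map Prod.fst)
    refine ⟨(w.map Prod.fst).count (some 0), by omega, h2, rfl, ?_, ?_, h4, h5, ?_, ?_, ?_, ?_⟩
    · simp only [List.length_map] at *
      omega
    · exact fun x hx => h3 _ (List.mem_map_of_mem hx)
    · intro x hx
      refine ⟨fun h => ?_, (h6 x hx).2⟩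
      obtain ⟨j, hj, hj1, -⟩ := (h6 x hx).1 h
      exact ⟨j, hj, hj1⟩
    · exact List.isChain_iff_pairwise.1 h7
    · intro j hj
      obtain ⟨x, hx, hxj⟩ := List.mem_filterMap.1 hj
      by_cases h : x.1 = none ∨ x.1 = some 0
      · obtain ⟨j', hj', -, hk⟩ := (h6 x hx).1 h
        obtain rfl : j' = j := by simpa [hxj] using hj'.symm
        exact hk
      · simp [(h6 x hx).2 h] at hxj
    · simp
  · rintro ⟨a, ha, h⟩
    refine ⟨⟨?_, h.count_up, ?_, h.ballot, h.chain⟩, ?_, List.isChain_iff_pairwise.2 h.sorted⟩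
    · have := h.length_eq
      simp only [List.length_map]
      omega
    · intro x hx
      obtain ⟨y, hy, rfl⟩ := List.mem_map.1 hx
      exact h.down_le y hy
    · intro x hx
      refine ⟨fun hx' => ?_, (h.labeled x hx).2⟩
      obtain ⟨j, hj, hj1⟩ := (h.labeled x hx).1 hx'
      exact ⟨j, hj, hj1, h.label_le j (List.mem_filterMap.2 ⟨x, hx, hj⟩)⟩

theorem succ_mul_card_isDLDWord (m k : ℕ) :
    (m + 1) * Nat.card {w : List (Option ℕ × Option ℕ) // IsDLDWord m k w} =
      k.multichoose m * (k + m + k * (m + 1)).multichoose m := by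
  have h (a : ℕ) (ha : a < m + 1) : ∃ q : ℕ, (q : ℤ) =
      prefixCount k (m + 1) (k * (m + 1)) a (m - a) ∧ HasPrefixCount k m a (m - a) 0 q :=
    HasPrefixCount.exists_all k m a (m - a) (by omega)
  choose! q hq H using h
  have hcard : {w : List (Option ℕ × Option ℕ) | IsDLDWord m k w}.encard =
      (∑ a ∈ Finset.range (m + 1), q a * k.multichoose (m + a) : ℕ) := by
    simp only [isDLDWord_iff]
    refine encard_setOf_exists_lt (fun a => {w | LabeledPrefix k m a (m - a) 0 k w}) _ _
      (fun a ha => H a ha k) fun a a' haa => Set.disjoint_left.2 fun w hw hw' => haa ?_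
    exact hw.count_zero.symm.trans hw'.count_zero
  have hcard' : Nat.card {w : List (Option ℕ × Option ℕ) // IsDLDWord m k w} =
      ∑ a ∈ Finset.range (m + 1), q a * k.multichoose (m + a) := by
    have := congrArg ENat.toNat hcard
    rwa [ENat.toNat_natCast] at this
  rw [hcard', Finset.mul_sum, ← Nat.sum_range_multichoose_mul, Finset.mul_sum]
  refine Finset.sum_congr rfl fun a ha => ?_
  have ha := Finset.mem_range.1 ha
  have h1 : (m + 1) * q a = (m + 1).multichoose a * (k * (m + 1)).multichoose (m - a) := by
    have h2 := mul_prefixCount k (m + 1) a (m - a)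
    rw [← hq a ha] at h2
    push_cast [Nat.cast_sub (show a ≤ m by omega)] at h2
    zify
    linear_combination h2
  rw [← mul_assoc, h1, ← mul_assoc, ← Nat.multichoose_succ_mul_multichoose]
  ring

theorem stmt8 (n k : ℕ) (hn : 2 ≤ n) (hk : 1 ≤ k) :
    (k * (n + 1) + n - 2) *
        Nat.card { w : List (Option ℕ × Option ℕ) // IsDLDWord (n - 1) k w }
      = Nat.choose (k * n + k + 2 * n - 3) n * Nat.choose (n + k - 2) (k - 1) := by
  obtain ⟨m, rfl⟩ : ∃ m, n = m + 1 := ⟨n - 1, by omega⟩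
  obtain ⟨k, rfl⟩ : ∃ k', k = k' + 1 := ⟨k - 1, by omega⟩
  have h := succ_mul_card_isDLDWord m (k + 1)
  have hc := Nat.choose_succ_right_eq ((k + 1) * (m + 1) + k + 2 * m) m
  rw [Nat.multichoose_eq, Nat.multichoose_eq,
    show k + 1 + m - 1 = k + m by omega,
    show k + 1 + m + (k + 1) * (m + 1) + m - 1 = (k + 1) * (m + 1) + k + 2 * m by omega,
    ← Nat.choose_symm_add (a := k)] at h
  rw [show (k + 1) * (m + 1) + k + 2 * m - m = (k + 1) * (m + 1) + k + m by omega] at hc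
  rw [show (k + 1) * (m + 1 + 1) + (m + 1) - 2 = (k + 1) * (m + 1) + k + m by
      rw [mul_add _ _ 1]; omega,
    show (k + 1) * (m + 1) + (k + 1) + 2 * (m + 1) - 3 = (k + 1) * (m + 1) + k + 2 * m by omega,
    show m + 1 + (k + 1) - 2 = k + m by omega, Nat.add_sub_cancel, Nat.add_sub_cancel]
  refine Nat.eq_of_mul_eq_mul_left m.succ_pos ?_
  rw [Nat.succ_eq_add_one]
  linear_combination ((k + 1) * (m + 1) + k + m) * h - (k + m).choose k * hc
end
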